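/- arXiv:1707.01705 — 7 statements merged into one kernel-verified Lean document; each statement's English description precedes it below -/
import Mathlib

section
/- The function R(z) = Γ(2z+1)/(2^{2z+1} Γ(z+1)²) is strictly decreasing on [0,∞); moreover R(0) = 1/2 and R(z) → 0 as z → ∞. -/
open Real Filter Set Topology

/-- Four-point inequality from log-convexity of Gamma. -/
lemma gamma_four_point {x y : ℝ} (hx : -(1/2) < x) (hxy : x < y) :
    Real.Gamma (x + 1) * Real.Gamma (y + 1/2) ≤ Real.Gamma (x + 1/2) * Real.Gamma (y + 1) := by
  have hs : 0 < x + 1/2 := by linarith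
  have ht : 0 < y + 1 := by linarith
  have hD : 0 < y - x + 1/2 := by linarith
  have ha : 0 < (y - x) / (y - x + 1/2) := div_pos (by linarith) hD
  have hb : 0 < (1/2) / (y - x + 1/2) := div_pos (by norm_num) hD
  have hab : (y - x) / (y - x + 1/2) + (1/2) / (y - x + 1/2) = 1 := by
    rw [← add_div]; exact div_self hD.ne'
  have e1 : (y - x) / (y - x + 1/2) * (x + 1/2) + (1/2) / (y - x + 1/2) * (y + 1) = x + 1 := by
    rw [div_mul_eq_mul_div, div_mul_eq_mul_div, ← add_div, div_eq_iff hD.ne']; ring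
  have e2 : (1/2) / (y - x + 1/2) * (x + 1/2) + (y - x) / (y - x + 1/2) * (y + 1) = y + 1/2 := by
    linear_combination (x + 1/2 + (y + 1)) * hab - e1
  have h1 := Real.Gamma_mul_add_mul_le_rpow_Gamma_mul_rpow_Gamma hs ht ha hb hab
  have h2 := Real.Gamma_mul_add_mul_le_rpow_Gamma_mul_rpow_Gamma hs ht hb ha (by linarith)
  rw [e1] at h1
  rw [e2] at h2
  have gs := Real.Gamma_pos_of_pos hs
  have gt := Real.Gamma_pos_of_pos ht
  have g1 : 0 < Real.Gamma (y + 1/2) := Real.Gamma_pos_of_pos (by linarith)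
  refine (mul_le_mul h1 h2 g1.le (by positivity)).trans (le_of_eq ?_)
  rw [mul_mul_mul_comm, ← Real.rpow_add gs, ← Real.rpow_add gt, hab,
    add_comm ((1/2) / (y - x + 1/2)), hab,
    Real.rpow_one, Real.rpow_one]

/-- The Gamma ratio. -/
noncomputable def gammaRatio (z : ℝ) : ℝ := Real.Gamma (z + 1/2) / Real.Gamma (z + 1)

lemma gammaRatio_pos {z : ℝ} (hz : -(1/2) < z) : 0 < gammaRatio z :=
  div_pos (Real.Gamma_pos_of_pos (by linarith)) (Real.Gamma_pos_of_pos (by linarith))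

lemma gammaRatio_le {x y : ℝ} (hx : -(1/2) < x) (hxy : x < y) :
    gammaRatio y ≤ gammaRatio x := by
  unfold gammaRatio
  rw [div_le_div_iff₀ (Real.Gamma_pos_of_pos (by linarith)) (Real.Gamma_pos_of_pos (by linarith))]
  linarith [gamma_four_point hx hxy]

lemma gammaRatio_rec {z : ℝ} (hz : -(1/2) < z) :
    gammaRatio z = gammaRatio (z + 1) * ((z + 1) / (z + 1/2)) := by
  unfold gammaRatio
  have h1 : z + 1/2 ≠ 0 := by linarith
  have h2 : z + 1 ≠ 0 := by linarith
  have g2 : Real.Gamma (z + 1) ≠ 0 := (Real.Gamma_pos_of_pos (by linarith)).ne'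
  rw [show z + 1 + 1/2 = (z + 1/2) + 1 by ring, Real.Gamma_add_one h1, Real.Gamma_add_one h2]
  generalize z + 1/2 = a at *
  generalize Real.Gamma (z + 1) = b at *
  field_simp

lemma gammaRatio_lt {x y : ℝ} (hx : -(1/2) < x) (hxy : x < y) :
    gammaRatio y < gammaRatio x := by
  rw [gammaRatio_rec hx, gammaRatio_rec (hx.trans hxy)]
  have h := gammaRatio_le (x := x + 1) (y := y + 1) (by linarith) (by linarith)
  have hp : 0 < gammaRatio (y + 1) := gammaRatio_pos (by linarith)
  have hx' : 0 < x + 1/2 := by linarith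
  have hq : (y + 1) / (y + 1/2) < (x + 1) / (x + 1/2) := by
    rw [div_lt_div_iff₀ (by linarith) hx']
    nlinarith
  have hq0 : 0 < (x + 1) / (x + 1/2) := div_pos (by linarith) hx'
  exact (mul_lt_mul_of_pos_left hq hp).trans_le (mul_le_mul_of_nonneg_right h hq0.le)

lemma gammaRatio_sq_le {z : ℝ} (hz : 0 < z) : gammaRatio z ^ 2 ≤ 1 / z := by
  have h := gammaRatio_le (x := z - 1/2) (y := z) (by linarith) (by linarith)
  have hp : 0 < gammaRatio z := gammaRatio_pos (by linarith)
  have e : gammaRatio z * gammaRatio (z - 1/2) = 1 / z := by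
    unfold gammaRatio
    have g1 : Real.Gamma z ≠ 0 := (Real.Gamma_pos_of_pos hz).ne'
    have g2 : Real.Gamma (z + 1/2) ≠ 0 := (Real.Gamma_pos_of_pos (by linarith)).ne'
    rw [show z - 1/2 + 1/2 = z by ring, show z - 1/2 + 1 = z + 1/2 by ring,
      Real.Gamma_add_one hz.ne']
    generalize Real.Gamma (z + 1/2) = b at *
    field_simp
  rw [← e, sq]
  exact mul_le_mul_of_nonneg_left h hp.le

lemma boundary_eq {z : ℝ} (hz : 0 ≤ z) :
    Real.Gamma (2 * z + 1) / (2 ^ (2 * z + 1) * (Real.Gamma (z + 1)) ^ 2)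
      = gammaRatio z / (2 * √π) := by
  have h := Real.Gamma_mul_Gamma_add_half (z + 1/2)
  rw [show z + 1/2 + 1/2 = z + 1 by ring, show 2 * (z + 1/2) = 2 * z + 1 by ring,
    show 1 - (2 * z + 1) = -(2 * z) by ring, Real.rpow_neg (by norm_num)] at h
  have g2 : Real.Gamma (z + 1) ≠ 0 := (Real.Gamma_pos_of_pos (by linarith)).ne'
  have hpi : √π ≠ 0 := (Real.sqrt_pos.2 Real.pi_pos).ne'
  have h2 : (2:ℝ) ^ (2 * z) ≠ 0 := (Real.rpow_pos_of_pos (by norm_num) _).ne'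
  rw [Real.rpow_add (by norm_num), Real.rpow_one]
  unfold gammaRatio
  generalize Real.Gamma (z + 1/2) = a at *
  generalize Real.Gamma (z + 1) = b at *
  generalize Real.Gamma (2 * z + 1) = c at *
  generalize (2:ℝ) ^ (2 * z) = d at *
  field_simp at h ⊢
  linarith

/-- The boundary variance constant `R(z) = Γ(2z+1)/(2^{2z+1} Γ(z+1)²)` is strictly
decreasing on `[0,∞)`, `R(0) = 1/2`, and `R(z) → 0` as `z → ∞`. -/
theorem boundary_constant_strictAnti :
    StrictAntiOn
        (fun z : ℝ => Real.Gamma (2 * z + 1) / (2 ^ (2 * z + 1) * (Real.Gamma (z + 1)) ^ 2))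
        (Set.Ici 0) ∧
      Real.Gamma (2 * (0:ℝ) + 1) / (2 ^ (2 * (0:ℝ) + 1) * (Real.Gamma ((0:ℝ) + 1)) ^ 2)
        = 1 / 2 ∧
      Filter.Tendsto
        (fun z : ℝ => Real.Gamma (2 * z + 1) / (2 ^ (2 * z + 1) * (Real.Gamma (z + 1)) ^ 2))
        Filter.atTop (nhds 0) := by
  have hpi : 0 < 2 * √π := mul_pos two_pos (Real.sqrt_pos.2 Real.pi_pos)
  refine ⟨?_, ?_, ?_⟩
  · intro x hx y hy hxy
    simp only [Set.mem_Ici] at hx hy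
    simp only [boundary_eq hx, boundary_eq hy]
    exact div_lt_div_of_pos_right (gammaRatio_lt (by linarith) hxy) hpi
  · norm_num [Real.Gamma_one]
  · have hsq : Tendsto (fun z => gammaRatio z ^ 2) atTop (𝓝 0) := by
      refine squeeze_zero' (Eventually.of_forall fun z => sq_nonneg _) ?_
        (tendsto_const_nhds.div_atTop tendsto_id : Tendsto (fun z : ℝ => 1 / z) atTop (𝓝 0))
      filter_upwards [eventually_gt_atTop 0] with z hz using gammaRatio_sq_le hz
    have h0 : Tendsto gammaRatio atTop (𝓝 0) := by
      have := hsq.sqrt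
      rw [Real.sqrt_zero] at this
      refine this.congr' ?_
      filter_upwards [eventually_gt_atTop 0] with z hz
      exact Real.sqrt_sq (gammaRatio_pos (by linarith)).le
    have h1 := h0.div_const (2 * √π)
    rw [zero_div] at h1
    refine h1.congr' ?_
    filter_upwards [eventually_ge_atTop 0] with z hz using (boundary_eq hz).symm
end

section
/- There exists a unique κ₀ > 0 such that Γ(2κ₀+1)/(2^{2κ₀+1} Γ(κ₀+1)²) = 1/(2√π); moreover 0.7 < κ₀ < 0.75, and Γ(2κ+1)/(2^{2κ+1} Γ(κ+1)²) − 1/(2√π) is positive for 0 ≤ κ < κ₀ and negative for κ > κ₀. -/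
open Real Filter Set

/-- The ratio `Γ(t+1/2)/Γ(t)`. -/
noncomputable def gq (t : ℝ) : ℝ := Real.Gamma (t + 1/2) / Real.Gamma t

lemma gq_pos {t : ℝ} (ht : 0 < t) : 0 < gq t :=
  div_pos (Real.Gamma_pos_of_pos (by linarith)) (Real.Gamma_pos_of_pos ht)

lemma gq_mono {x y : ℝ} (hx : 0 < x) (hxy : x ≤ y) : gq x ≤ gq y := by
  have hy : 0 < y := by linarith
  have hL : 0 < y - x + 1/2 := by linarith
  have hL' : (y - x) * 2 + 1 ≠ 0 := by linarith
  have hx' : x ∈ Ioi (0:ℝ) := hx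
  have hy' : y + 1/2 ∈ Ioi (0:ℝ) := by show 0 < y + 1/2; linarith
  have hsum : (y - x) / (y - x + 1/2) + (1/2) / (y - x + 1/2) = 1 := by
    field_simp
  have ha : 0 ≤ (y - x) / (y - x + 1/2) := div_nonneg (by linarith) hL.le
  have hb : 0 ≤ (1/2) / (y - x + 1/2) := div_nonneg (by norm_num) hL.le
  have h1 := Real.convexOn_log_Gamma.2 hx' hy' ha hb hsum
  have h2 := Real.convexOn_log_Gamma.2 hx' hy' hb ha (by rw [add_comm]; exact hsum)
  simp only [smul_eq_mul, Function.comp] at h1 h2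
  have e1 : (y - x) / (y - x + 1/2) * x + (1/2) / (y - x + 1/2) * (y + 1/2) = x + 1/2 := by
    field_simp; ring
  have e2 : (1/2) / (y - x + 1/2) * x + (y - x) / (y - x + 1/2) * (y + 1/2) = y := by
    linear_combination (x + y + 1/2) * hsum - e1
  rw [e1] at h1
  rw [e2] at h2
  have px := Real.Gamma_pos_of_pos hx
  have py := Real.Gamma_pos_of_pos hy
  have px2 := Real.Gamma_pos_of_pos (show 0 < x + 1/2 by linarith)
  have py2 := Real.Gamma_pos_of_pos (show 0 < y + 1/2 by linarith)
  have key : log (Gamma (x + 1/2)) + log (Gamma y) ≤ log (Gamma x) + log (Gamma (y + 1/2)) := by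
    have e3 : (1/2) / (y - x + 1/2) = 1 - (y - x) / (y - x + 1/2) := by linarith
    rw [e3] at h1 h2
    linarith
  rw [← Real.log_mul px2.ne' py.ne', ← Real.log_mul px.ne' py2.ne',
    Real.log_le_log_iff (mul_pos px2 py) (mul_pos px py2)] at key
  unfold gq
  rw [div_le_div_iff₀ px py]
  linarith

lemma gq_succ {t : ℝ} (ht : 0 < t) : gq t = gq (t + 1) * (t / (t + 1/2)) := by
  unfold gq
  have e : t + 1 + 1/2 = (t + 1/2) + 1 := by ring
  rw [e, Real.Gamma_add_one (by linarith : t + 1/2 ≠ 0), Real.Gamma_add_one ht.ne']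
  have := (Real.Gamma_pos_of_pos ht).ne'
  have : t + 1/2 ≠ 0 := by linarith
  field_simp

lemma gq_half {t : ℝ} (ht : 0 < t) : gq t * gq (t + 1/2) = t := by
  unfold gq
  have e : t + 1/2 + 1/2 = t + 1 := by ring
  rw [e, Real.Gamma_add_one ht.ne']
  have := (Real.Gamma_pos_of_pos ht).ne'
  have := (Real.Gamma_pos_of_pos (show 0 < t + 1/2 by linarith)).ne'
  field_simp

lemma gq_strict {x y : ℝ} (hx : 0 < x) (hxy : x < y) : gq x < gq y := by
  have hy : 0 < y := by linarith
  rw [gq_succ hx, gq_succ hy]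
  have h1 := gq_mono (show 0 < x + 1 by linarith) (show x + 1 ≤ y + 1 by linarith)
  have h2 : x / (x + 1/2) < y / (y + 1/2) := by
    rw [div_lt_div_iff₀ (by linarith) (by linarith)]; linarith
  have h3 := gq_pos (show 0 < x + 1 by linarith)
  have h4 : 0 < y / (y + 1/2) := by positivity
  calc gq (x+1) * (x / (x + 1/2)) < gq (x+1) * (y / (y + 1/2)) := by gcongr
    _ ≤ _ := by gcongr

lemma gq_prod {t : ℝ} (ht : 0 < t) (n : ℕ) :
    gq t = gq (t + n) * ∏ k ∈ Finset.range n, ((t + k) / (t + k + 1/2)) := by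
  induction n with
  | zero => simp
  | succ n ih =>
    rw [Finset.prod_range_succ, ih, gq_succ (show 0 < t + n by positivity)]
    push_cast
    rw [← add_assoc]
    ring

lemma gq_sq_le {t : ℝ} (ht : 0 < t) : gq t ^ 2 ≤ t := by
  have h := gq_half ht
  have := gq_mono ht (show t ≤ t + 1/2 by linarith)
  nlinarith [gq_pos ht]

lemma le_gq_sq {t : ℝ} (ht : 0 < t) : t ≤ gq (t + 1/2) ^ 2 := by
  have h := gq_half ht
  have := gq_mono ht (show t ≤ t + 1/2 by linarith)
  nlinarith [gq_pos ht]

lemma gq_low : gq (6/5) < 1 := by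
  have h := gq_prod (show (0:ℝ) < 6/5 by norm_num) 24
  have h2 := gq_sq_le (show (0:ℝ) < 6/5 + (24:ℕ) by norm_num)
  have h3 : gq (6/5) ^ 2 < 1 := by
    rw [h, mul_pow]
    refine lt_of_le_of_lt (mul_le_mul_of_nonneg_right h2 (sq_nonneg _)) ?_
    norm_num [Finset.prod_range_succ]
  nlinarith [gq_pos (show (0:ℝ) < 6/5 by norm_num)]

lemma gq_high : 1 < gq (5/4) := by
  have h := gq_prod (show (0:ℝ) < 5/4 by norm_num) 24
  have h2 := le_gq_sq (show (0:ℝ) < 3/4 + (24:ℕ) by norm_num)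
  have e : (3/4 + (24:ℕ) + 1/2 : ℝ) = 5/4 + (24:ℕ) := by norm_num
  rw [e] at h2
  have h3 : 1 < gq (5/4) ^ 2 := by
    rw [h, mul_pow]
    refine lt_of_lt_of_le ?_ (mul_le_mul_of_nonneg_right h2 (sq_nonneg _))
    norm_num [Finset.prod_range_succ]
  nlinarith [gq_pos (show (0:ℝ) < 5/4 by norm_num)]

lemma gq_cont : ContinuousOn gq (Icc (6/5) (5/4)) := by
  intro t ht
  have h0 : 0 < t := by linarith [ht.1]
  have hd : ∀ s : ℝ, 0 < s → ContinuousAt Real.Gamma s := fun s hs =>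
    (Real.differentiableAt_Gamma (fun m => by
      have : (0:ℝ) ≤ m := Nat.cast_nonneg m
      linarith)).continuousAt
  apply ContinuousAt.continuousWithinAt
  unfold gq
  refine ContinuousAt.div ?_ (hd t h0) (Real.Gamma_pos_of_pos h0).ne'
  exact ContinuousAt.comp (f := fun t : ℝ => t + 1/2) (hd _ (by linarith)) (by fun_prop)

lemma R_eq {κ : ℝ} (hκ : 0 ≤ κ) :
    Real.Gamma (2 * κ + 1) / (2 ^ (2 * κ + 1) * (Real.Gamma (κ + 1)) ^ 2)
      = 1 / (2 * Real.sqrt π) * (1 / gq (κ + 1/2)) := by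
  have h := Real.Gamma_mul_Gamma_add_half (κ + 1/2)
  have e1 : κ + 1/2 + 1/2 = κ + 1 := by ring
  have e2 : 2 * (κ + 1/2) = 2 * κ + 1 := by ring
  have e3 : 1 - (2 * κ + 1) = -(2 * κ) := by ring
  rw [e1, e2, e3, Real.rpow_neg (by norm_num)] at h
  unfold gq
  rw [e1, Real.rpow_add (by norm_num), Real.rpow_one]
  have p1 := Real.Gamma_pos_of_pos (show 0 < κ + 1 by linarith)
  have p2 := Real.Gamma_pos_of_pos (show 0 < κ + 1/2 by linarith)
  have p3 : (0:ℝ) < 2 ^ (2 * κ) := by positivity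
  have p4 : 0 < √π := Real.sqrt_pos.2 Real.pi_pos
  have h' : Gamma (2 * κ + 1) = Gamma (κ + 1/2) * Gamma (κ + 1) * 2 ^ (2 * κ) / √π := by
    rw [h]; field_simp
  rw [h']
  field_simp

/-- There is a unique `κ₀ > 0` with `Γ(2κ₀+1)/(2^{2κ₀+1} Γ(κ₀+1)²) = 1/(2√π)`; moreover
`0.7 < κ₀ < 0.75`, and `Γ(2κ+1)/(2^{2κ+1} Γ(κ+1)²) − 1/(2√π)` is positive for
`0 ≤ κ < κ₀` and negative for `κ > κ₀`. -/
theorem boundary_constant_crossing :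
    ∃ κ₀ : ℝ, 0 < κ₀ ∧
      Real.Gamma (2 * κ₀ + 1) / (2 ^ (2 * κ₀ + 1) * (Real.Gamma (κ₀ + 1)) ^ 2)
        = 1 / (2 * Real.sqrt π) ∧
      (∀ κ : ℝ, 0 < κ →
        Real.Gamma (2 * κ + 1) / (2 ^ (2 * κ + 1) * (Real.Gamma (κ + 1)) ^ 2)
          = 1 / (2 * Real.sqrt π) → κ = κ₀) ∧
      0.7 < κ₀ ∧ κ₀ < 0.75 ∧
      (∀ κ : ℝ, 0 ≤ κ → κ < κ₀ →
        0 < Real.Gamma (2 * κ + 1) / (2 ^ (2 * κ + 1) * (Real.Gamma (κ + 1)) ^ 2)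
          - 1 / (2 * Real.sqrt π)) ∧
      (∀ κ : ℝ, κ₀ < κ →
        Real.Gamma (2 * κ + 1) / (2 ^ (2 * κ + 1) * (Real.Gamma (κ + 1)) ^ 2)
          - 1 / (2 * Real.sqrt π) < 0) := by
  obtain ⟨t, ⟨ht1, ht2⟩, ht⟩ :=
    intermediate_value_Ioo (by norm_num : (6/5 : ℝ) ≤ 5/4) gq_cont ⟨gq_low, gq_high⟩
  have hc : 0 < 1 / (2 * √π) := by
    have : 0 < √π := Real.sqrt_pos.2 Real.pi_pos
    positivity
  have hpos : ∀ κ : ℝ, 0 ≤ κ → κ < t - 1/2 →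
        0 < Real.Gamma (2 * κ + 1) / (2 ^ (2 * κ + 1) * (Real.Gamma (κ + 1)) ^ 2)
          - 1 / (2 * Real.sqrt π) := by
    intro κ h0 h1
    rw [R_eq h0]
    have h2 := gq_strict (show 0 < κ + 1/2 by linarith) (show κ + 1/2 < t by linarith)
    rw [ht] at h2
    have h3 := one_lt_one_div (gq_pos (show 0 < κ + 1/2 by linarith)) h2
    nlinarith
  have hneg : ∀ κ : ℝ, t - 1/2 < κ →
        Real.Gamma (2 * κ + 1) / (2 ^ (2 * κ + 1) * (Real.Gamma (κ + 1)) ^ 2)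
          - 1 / (2 * Real.sqrt π) < 0 := by
    intro κ h1
    rw [R_eq (by linarith)]
    have h2 := gq_strict (show 0 < t by linarith) (show t < κ + 1/2 by linarith)
    rw [ht] at h2
    have h3 : 1 / gq (κ + 1/2) < 1 := by
      rw [div_lt_one (by linarith)]; exact h2
    nlinarith
  refine ⟨t - 1/2, by linarith, ?_, ?_, by norm_num; linarith, by norm_num; linarith, hpos, hneg⟩
  · rw [R_eq (by linarith), sub_add_cancel, ht]; simp
  · intro κ h0 h
    rcases lt_trichotomy κ (t - 1/2) with h1 | h1 | h1
    · have := hpos κ h0.le h1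
      rw [h] at this; linarith
    · exact h1
    · have := hneg κ h1
      rw [h] at this; linarith
end

section
/- Let m ≥ 0 and suppose that for h ∈ (0,1) positive reals α_h (shape) and θ_h (scale) satisfy α_h·θ_h → m and α_h·θ_h² → 0 as h → 0⁺. Then the Gamma distributions with shape α_h and scale θ_h converge weakly to the Dirac point mass at m as h → 0⁺; equivalently, ∫₀^∞ φ(u) K_{G(α_h,θ_h)}(u) du → φ(m) for every bounded continuous φ : ℝ → ℝ. In particular, for x ≥ 0 the Gamma distribution with shape x/h + 1 and scale h converges weakly to the point mass at x as h → 0⁺. -/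
open Real Filter Set MeasureTheory Topology

/-- The Gamma kernel with shape `α` and scale `θ`:
`K_{G(α,θ)}(u) = u^{α−1} e^{−u/θ} / (θ^α Γ(α))`. -/
noncomputable def gammaKernel (α θ u : ℝ) : ℝ :=
  u ^ (α - 1) * Real.exp (-u / θ) / (θ ^ α * Real.Gamma α)

lemma gk_integral {a t : ℝ} (ha : 0 < a) (ht : 0 < t) :
    ∫ u in Set.Ioi (0:ℝ), gammaKernel a t u = 1 := by
  have h := Real.integral_rpow_mul_exp_neg_mul_Ioi ha (inv_pos.2 ht)
  have hG := Real.Gamma_pos_of_pos ha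
  have ht' := Real.rpow_pos_of_pos ht a
  have h2 : ∀ u : ℝ, gammaKernel a t u
      = (u ^ (a - 1) * Real.exp (-(t⁻¹ * u))) * (t ^ a * Real.Gamma a)⁻¹ := by
    intro u
    unfold gammaKernel
    rw [div_eq_mul_inv]
    congr 3
    ring
  simp_rw [h2]
  rw [integral_mul_const, h]
  simp only [one_div, inv_inv]
  field_simp

lemma gk_integrable {a t : ℝ} (ha : 0 < a) (ht : 0 < t) :
    IntegrableOn (gammaKernel a t) (Set.Ioi (0:ℝ)) := by
  by_contra hc
  have h := gk_integral ha ht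
  rw [integral_undef hc] at h
  exact zero_ne_one h

lemma gk_mul {a t u : ℝ} (ha : 0 < a) (ht : 0 < t) (hu : 0 < u) :
    u * gammaKernel a t u = a * t * gammaKernel (a + 1) t u := by
  unfold gammaKernel
  have hG := Real.Gamma_pos_of_pos ha
  have ht' := Real.rpow_pos_of_pos ht a
  rw [Real.Gamma_add_one ha.ne', Real.rpow_add_one ht.ne',
    show a + 1 - 1 = (a - 1) + 1 by ring, Real.rpow_add_one hu.ne']
  field_simp

lemma gk_nonneg {a t u : ℝ} (ha : 0 < a) (ht : 0 < t) (hu : 0 < u) :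
    0 ≤ gammaKernel a t u := by
  unfold gammaKernel
  have hG := Real.Gamma_pos_of_pos ha
  positivity

lemma gk_sq_eq {a t : ℝ} (m : ℝ) (ha : 0 < a) (ht : 0 < t) :
    Set.EqOn (fun u => (u - m) ^ 2 * gammaKernel a t u)
      (fun u => a * (a + 1) * t ^ 2 * gammaKernel (a + 1 + 1) t u
        - 2 * m * a * t * gammaKernel (a + 1) t u + m ^ 2 * gammaKernel a t u)
      (Set.Ioi (0:ℝ)) := by
  intro u hu
  have h1 := gk_mul ha ht hu
  have h2 := gk_mul (a := a + 1) (by positivity) ht hu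
  simp only
  linear_combination (u - 2 * m) * h1 + a * t * h2

lemma gk_sq_integrable {a t : ℝ} (m : ℝ) (ha : 0 < a) (ht : 0 < t) :
    IntegrableOn (fun u => (u - m) ^ 2 * gammaKernel a t u) (Set.Ioi (0:ℝ)) := by
  rw [integrableOn_congr_fun (gk_sq_eq m ha ht) measurableSet_Ioi]
  exact (((gk_integrable (by positivity) ht).const_mul _).sub
    ((gk_integrable (by positivity) ht).const_mul _)).add ((gk_integrable ha ht).const_mul _)

lemma gk_sq_integral {a t : ℝ} (m : ℝ) (ha : 0 < a) (ht : 0 < t) :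
    ∫ u in Set.Ioi (0:ℝ), (u - m) ^ 2 * gammaKernel a t u = a * t ^ 2 + (a * t - m) ^ 2 := by
  have i0 : Integrable (gammaKernel a t) (volume.restrict (Set.Ioi 0)) := gk_integrable ha ht
  have i1 : Integrable (gammaKernel (a + 1) t) (volume.restrict (Set.Ioi 0)) :=
    gk_integrable (by positivity) ht
  have i2 : Integrable (gammaKernel (a + 1 + 1) t) (volume.restrict (Set.Ioi 0)) :=
    gk_integrable (by positivity) ht
  have i3 : Integrable (fun u => a * (a + 1) * t ^ 2 * gammaKernel (a + 1 + 1) t u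
      - 2 * m * a * t * gammaKernel (a + 1) t u) (volume.restrict (Set.Ioi 0)) :=
    (i2.const_mul _).sub (i1.const_mul _)
  rw [setIntegral_congr_fun measurableSet_Ioi (gk_sq_eq m ha ht),
    integral_add i3 (i0.const_mul _),
    integral_sub (i2.const_mul _) (i1.const_mul _), integral_const_mul, integral_const_mul,
    integral_const_mul, gk_integral ha ht, gk_integral (by positivity) ht,
    gk_integral (by positivity) ht]
  ring

lemma gk_bound {a t m C e d : ℝ} (ha : 0 < a) (ht : 0 < t) (hd : 0 < d) (he : 0 ≤ e)
    {φ : ℝ → ℝ} (hφ : Continuous φ) (hC : ∀ u, |φ u| ≤ C)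
    (hloc : ∀ u, |u - m| < d → |φ u - φ m| ≤ e) :
    |(∫ u in Set.Ioi (0:ℝ), φ u * gammaKernel a t u) - φ m|
      ≤ e + 2 * C / d ^ 2 * (a * t ^ 2 + (a * t - m) ^ 2) := by
  have i0 : Integrable (gammaKernel a t) (volume.restrict (Set.Ioi 0)) := gk_integrable ha ht
  have i2 : Integrable (fun u => (u - m) ^ 2 * gammaKernel a t u)
    (volume.restrict (Set.Ioi 0)) := gk_sq_integrable m ha ht
  have iφ : Integrable (fun u => φ u * gammaKernel a t u) (volume.restrict (Set.Ioi 0)) :=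
    i0.bdd_mul hφ.aestronglyMeasurable (Eventually.of_forall hC)
  have hC0 : 0 ≤ C := (abs_nonneg _).trans (hC 0)
  have e1 : (∫ u in Set.Ioi (0:ℝ), φ u * gammaKernel a t u) - φ m
      = ∫ u in Set.Ioi (0:ℝ), (φ u * gammaKernel a t u - φ m * gammaKernel a t u) := by
    rw [integral_sub iφ (i0.const_mul _), integral_const_mul, gk_integral ha ht, mul_one]
  have e2 : e + 2 * C / d ^ 2 * (a * t ^ 2 + (a * t - m) ^ 2)
      = ∫ u in Set.Ioi (0:ℝ), (e * gammaKernel a t u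
        + 2 * C / d ^ 2 * ((u - m) ^ 2 * gammaKernel a t u)) := by
    rw [integral_add (i0.const_mul _) (i2.const_mul _), integral_const_mul, integral_const_mul,
      gk_integral ha ht, gk_sq_integral m ha ht, mul_one]
  rw [e1, e2, ← Real.norm_eq_abs]
  refine norm_integral_le_of_norm_le ((i0.const_mul _).add (i2.const_mul _)) ?_
  filter_upwards [ae_restrict_mem measurableSet_Ioi] with u hu
  have hk := gk_nonneg ha ht hu
  rw [← sub_mul, norm_mul, Real.norm_eq_abs, Real.norm_eq_abs, abs_of_nonneg hk, ← mul_assoc,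
    ← add_mul]
  refine mul_le_mul_of_nonneg_right ?_ hk
  by_cases hu' : |u - m| < d
  · have : 0 ≤ 2 * C / d ^ 2 * (u - m) ^ 2 := by positivity
    linarith [hloc u hu']
  · have h1 : d ^ 2 ≤ (u - m) ^ 2 := by
      rw [← sq_abs (u - m)]
      exact pow_le_pow_left₀ hd.le (not_lt.1 hu') 2
    have h2 : 2 * C ≤ 2 * C / d ^ 2 * (u - m) ^ 2 := by
      rw [div_mul_eq_mul_div, le_div_iff₀ (by positivity)]
      exact mul_le_mul_of_nonneg_left h1 (by positivity)
    have h3 : |φ u - φ m| ≤ |φ u| + |φ m| := abs_sub _ _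
    linarith [hC u, hC m]

lemma gk_tendsto (m : ℝ) (α θ : ℝ → ℝ)
    (hα : ∀ h ∈ Set.Ioo (0:ℝ) 1, 0 < α h) (hθ : ∀ h ∈ Set.Ioo (0:ℝ) 1, 0 < θ h)
    (hmean : Filter.Tendsto (fun h => α h * θ h) (nhdsWithin 0 (Set.Ioi 0)) (nhds m))
    (hvar : Filter.Tendsto (fun h => α h * (θ h) ^ 2) (nhdsWithin 0 (Set.Ioi 0)) (nhds 0))
    (φ : ℝ → ℝ) (hφ : Continuous φ) (hb : ∃ C, ∀ u, |φ u| ≤ C) :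
    Filter.Tendsto (fun h => ∫ u in Set.Ioi (0:ℝ), φ u * gammaKernel (α h) (θ h) u)
        (nhdsWithin 0 (Set.Ioi 0)) (nhds (φ m)) := by
  obtain ⟨C, hC⟩ := hb
  rw [Metric.tendsto_nhds]
  intro ε hε
  obtain ⟨d, hd, hloc⟩ := Metric.continuous_iff.1 hφ m (ε / 2) (by positivity)
  have hlim : Filter.Tendsto
      (fun h => ε / 2 + 2 * C / d ^ 2 * (α h * (θ h) ^ 2 + (α h * θ h - m) ^ 2))
      (nhdsWithin 0 (Set.Ioi 0)) (nhds (ε / 2)) := by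
    have := ((hvar.add ((hmean.sub_const m).pow 2)).const_mul (2 * C / d ^ 2)).const_add (ε / 2)
    simpa using this
  filter_upwards [hlim.eventually (gt_mem_nhds (half_lt_self hε)),
    Ioo_mem_nhdsGT (zero_lt_one (α := ℝ))] with h h1 h2
  rw [Real.dist_eq]
  refine (gk_bound (hα h h2) (hθ h h2) hd (half_pos hε).le hφ hC ?_).trans_lt h1
  intro u hu
  exact (hloc u hu).le

/-- If the shapes `α h` and scales `θ h` are positive for `h ∈ (0,1)` and satisfy
`α h · θ h → m ≥ 0` and `α h · θ h² → 0` as `h → 0⁺`, then the corresponding Gamma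
distributions converge weakly to the point mass at `m`, in the sense that
`∫₀^∞ φ(u) K_{G(α h, θ h)}(u) du → φ(m)` for every bounded continuous `φ`.
In particular, for `x ≥ 0` the Gamma distribution with shape `x/h + 1` and scale `h`
converges weakly to the point mass at `x` as `h → 0⁺`. -/
theorem gamma_weak_convergence (m : ℝ) (hm : 0 ≤ m) (α θ : ℝ → ℝ)
    (hα : ∀ h ∈ Set.Ioo (0:ℝ) 1, 0 < α h) (hθ : ∀ h ∈ Set.Ioo (0:ℝ) 1, 0 < θ h)
    (hmean : Filter.Tendsto (fun h => α h * θ h) (nhdsWithin 0 (Set.Ioi 0)) (nhds m))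
    (hvar : Filter.Tendsto (fun h => α h * (θ h) ^ 2) (nhdsWithin 0 (Set.Ioi 0)) (nhds 0)) :
    (∀ φ : ℝ → ℝ, Continuous φ → (∃ C, ∀ u, |φ u| ≤ C) →
      Filter.Tendsto (fun h => ∫ u in Set.Ioi (0:ℝ), φ u * gammaKernel (α h) (θ h) u)
        (nhdsWithin 0 (Set.Ioi 0)) (nhds (φ m))) ∧
    (∀ x : ℝ, 0 ≤ x → ∀ φ : ℝ → ℝ, Continuous φ → (∃ C, ∀ u, |φ u| ≤ C) →
      Filter.Tendsto (fun h => ∫ u in Set.Ioi (0:ℝ), φ u * gammaKernel (x / h + 1) h u)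
        (nhdsWithin 0 (Set.Ioi 0)) (nhds (φ x))) := by

  refine ⟨fun φ hφ hb => gk_tendsto m α θ hα hθ hmean hvar φ hφ hb, fun x hx φ hφ hb => ?_⟩
  have hid : Filter.Tendsto (fun h : ℝ => h) (nhdsWithin 0 (Set.Ioi 0)) (nhds 0) :=
    tendsto_nhdsWithin_of_tendsto_nhds tendsto_id
  refine gk_tendsto x (fun h => x / h + 1) (fun h => h) (fun h hh => ?_) (fun h hh => hh.1)
    ?_ ?_ φ hφ hb
  · have := div_nonneg hx hh.1.le
    positivity
  · have h1 : Filter.Tendsto (fun h : ℝ => x + h) (nhdsWithin 0 (Set.Ioi 0)) (nhds x) := by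
      simpa using hid.const_add x
    refine h1.congr' ?_
    filter_upwards [self_mem_nhdsWithin] with h hh
    have hh' : h ≠ 0 := ne_of_gt hh
    field_simp
  · have h1 : Filter.Tendsto (fun h : ℝ => x * h + h ^ 2) (nhdsWithin 0 (Set.Ioi 0)) (nhds 0) := by
      simpa using (hid.const_mul x).add (hid.pow 2)
    refine h1.congr' ?_
    filter_upwards [self_mem_nhdsWithin] with h hh
    have hh' : h ≠ 0 := ne_of_gt hh
    field_simp
end

section
/- For every x ≥ 0 and every integer l ≥ 3, E[(ξ_{x,h} − x)^l] = O(h²) as h → 0⁺; that is, there exist constants C > 0 and h₀ > 0 (depending on x and l) such that |E[(ξ_{x,h} − x)^l]| ≤ C h² for all 0 < h < h₀. -/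
open Real Filter Set MeasureTheory

/-- `E[f(ξ_{x,h})] = ∫₀^∞ f(u) K_{G(x/h+1,h)}(u) du`. -/
noncomputable def Egamma (x h : ℝ) (f : ℝ → ℝ) : ℝ :=
  ∫ u in Set.Ioi (0:ℝ), f u * gammaKernel (x / h + 1) h u

open Polynomial in
lemma gm_moment (x h : ℝ) (hx : 0 ≤ x) (hh : 0 < h) (k : ℕ) :
    IntegrableOn (fun u : ℝ => u ^ k * gammaKernel (x / h + 1) h u) (Ioi 0) ∧
    ∫ u in Ioi (0:ℝ), u ^ k * gammaKernel (x / h + 1) h u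
      = h ^ k * Real.Gamma (x / h + 1 + k) / Real.Gamma (x / h + 1) := by
  have ha : 0 < x / h + 1 := by positivity
  set a := x / h + 1 with ha'
  have hG := Real.Gamma_pos_of_pos ha
  have hak : 0 < a + k := by positivity
  have hG2 := Real.Gamma_pos_of_pos hak
  have hp : 0 < h ^ a := Real.rpow_pos_of_pos hh _
  have key : ∫ u in Ioi (0:ℝ), u ^ k * gammaKernel a h u
      = h ^ k * Real.Gamma (a + k) / Real.Gamma a := by
    have h1 : ∫ u in Ioi (0:ℝ), u ^ k * gammaKernel a h u =
        ∫ u in Ioi (0:ℝ), (u ^ (a + k - 1) * Real.exp (-(h⁻¹ * u))) *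
          (h ^ a * Real.Gamma a)⁻¹ := by
      refine setIntegral_congr_fun measurableSet_Ioi (fun u hu => ?_)
      have hu : 0 < u := hu
      simp only [gammaKernel]
      rw [show a + k - 1 = (a - 1) + k by ring, Real.rpow_add hu, Real.rpow_natCast,
        show -(h⁻¹ * u) = -u / h by field_simp]
      ring
    rw [h1, integral_mul_const, Real.integral_rpow_mul_exp_neg_mul_Ioi hak (inv_pos.2 hh)]
    rw [one_div, inv_inv, Real.rpow_add hh, Real.rpow_natCast]
    field_simp
  refine ⟨?_, key⟩
  apply Integrable.of_integral_ne_zero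
  rw [key]; positivity

lemma gm_int (x h : ℝ) (hx : 0 ≤ x) (hh : 0 < h) (p : Polynomial ℝ) :
    IntegrableOn (fun u : ℝ => p.eval u * gammaKernel (x / h + 1) h u) (Ioi 0) := by
  induction p using Polynomial.induction_on' with
  | add p q hp hq =>
    simp only [Polynomial.eval_add, add_mul]
    exact hp.add hq
  | monomial n c =>
    simp only [Polynomial.eval_monomial, mul_assoc]
    exact (gm_moment x h hx hh n).1.const_mul c

lemma gm_add (x h : ℝ) (hx : 0 ≤ x) (hh : 0 < h) (p q : Polynomial ℝ) :
    Egamma x h (fun u => (p + q).eval u)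
      = Egamma x h (fun u => p.eval u) + Egamma x h (fun u => q.eval u) := by
  simp only [Egamma, Polynomial.eval_add, add_mul]
  exact integral_add (gm_int x h hx hh p) (gm_int x h hx hh q)

lemma gm_smul (x h c : ℝ) (p : Polynomial ℝ) :
    Egamma x h (fun u => (Polynomial.C c * p).eval u)
      = c * Egamma x h (fun u => p.eval u) := by
  simp only [Egamma, Polynomial.eval_mul, Polynomial.eval_C, mul_assoc]
  exact integral_const_mul _ _

lemma gm_pow (x h : ℝ) (hx : 0 ≤ x) (hh : 0 < h) (k : ℕ) :
    Egamma x h (fun u => (Polynomial.X ^ (k + 1) : Polynomial ℝ).eval u)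
      = (x + (k + 1) * h) * Egamma x h (fun u => (Polynomial.X ^ k : Polynomial ℝ).eval u) := by
  simp only [Egamma, Polynomial.eval_pow, Polynomial.eval_X]
  rw [(gm_moment x h hx hh _).2, (gm_moment x h hx hh _).2]
  have ha : 0 < x / h + 1 + k := by positivity
  push_cast
  rw [← add_assoc, Real.Gamma_add_one ha.ne']
  field_simp
  ring

open Polynomial in
lemma gm_stein (x h : ℝ) (hx : 0 ≤ x) (hh : 0 < h) (p : Polynomial ℝ) :
    Egamma x h (fun u => (X * p).eval u)
      = x * Egamma x h (fun u => p.eval u)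
        + h * Egamma x h (fun u => (derivative (X * p)).eval u) := by
  induction p using Polynomial.induction_on' with
  | add p q hp hq =>
    rw [mul_add, derivative_add, gm_add x h hx hh, gm_add x h hx hh, gm_add x h hx hh, hp, hq]
    ring
  | monomial n c =>
    have e1 : (X * monomial n c : ℝ[X]) = C c * X ^ (n + 1) := by
      rw [← C_mul_X_pow_eq_monomial]; ring
    have e2 : derivative (C c * X ^ (n + 1) : ℝ[X]) = C (c * (n + 1)) * X ^ n := by
      simp [derivative_X_pow]; ring
    rw [e1, e2, ← C_mul_X_pow_eq_monomial, gm_smul, gm_smul, gm_smul, gm_pow x h hx hh]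
    ring

open Polynomial in
lemma gm_rec (x h : ℝ) (hx : 0 ≤ x) (hh : 0 < h) (n : ℕ) :
    Egamma x h (fun u => (u - x) ^ (n + 2))
      = h * ((n + 2) * Egamma x h (fun u => (u - x) ^ (n + 1))
        + (n + 1) * x * Egamma x h (fun u => (u - x) ^ n)) := by
  have ev : ∀ m : ℕ, Egamma x h (fun u => (u - x) ^ m)
      = Egamma x h (fun u => ((X - C x) ^ m : ℝ[X]).eval u) := by
    intro m; simp
  have hs := gm_stein x h hx hh ((X - C x) ^ (n + 1))
  have e1 : (X * (X - C x) ^ (n + 1) : ℝ[X])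
      = (X - C x) ^ (n + 2) + C x * (X - C x) ^ (n + 1) := by ring
  have e2 : derivative (X * (X - C x) ^ (n + 1) : ℝ[X])
      = C ((n : ℝ) + 2) * (X - C x) ^ (n + 1) + C (((n : ℝ) + 1) * x) * (X - C x) ^ n := by
    rw [derivative_mul, derivative_X_sub_C_pow]
    simp only [derivative_X, map_add, map_mul, map_natCast, Nat.cast_add, Nat.cast_one,
      Nat.add_sub_cancel, map_ofNat, map_one]
    ring
  rw [e2, gm_add x h hx hh, gm_smul, gm_smul, e1, gm_add x h hx hh, gm_smul] at hs
  rw [ev, ev, ev]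
  linarith

lemma gm_zero (x h : ℝ) (hx : 0 ≤ x) (hh : 0 < h) :
    Egamma x h (fun u => (u - x) ^ 0) = 1 := by
  have := (gm_moment x h hx hh 0).2
  have ha : 0 < x / h + 1 := by positivity
  have hG := Real.Gamma_pos_of_pos ha
  simp only [pow_zero, Nat.cast_zero, add_zero, one_mul] at this
  simp only [Egamma, pow_zero, one_mul]
  rw [this, div_self hG.ne']

open Polynomial in
lemma gm_one (x h : ℝ) (hx : 0 ≤ x) (hh : 0 < h) :
    Egamma x h (fun u => (u - x) ^ 1) = h := by
  have h0 := gm_zero x h hx hh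
  have h1 := gm_pow x h hx hh 0
  have h2 := gm_add x h hx hh X (C (-x) * 1)
  rw [gm_smul] at h2
  simp only [Egamma, eval_add, eval_X, eval_mul, eval_C, eval_one, mul_one, eval_pow, pow_zero,
    pow_one, zero_add, ← sub_eq_add_neg, Nat.cast_zero] at h0 h1 h2 ⊢
  rw [h2, h1, h0]; ring

lemma gm_bound (x : ℝ) (hx : 0 ≤ x) (n : ℕ) :
    ∃ C > 0, ∀ h : ℝ, 0 < h → h < 1 →
      |Egamma x h (fun u => (u - x) ^ (n + 3))| ≤ C * h ^ 2 ∧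
      |Egamma x h (fun u => (u - x) ^ (n + 4))| ≤ C * h ^ 2 := by
  induction n with
  | zero =>
    refine ⟨(6 + 5 * x) + (4 * (6 + 5 * x) + 3 * x * (2 + x)), by positivity, fun h hh h1 => ?_⟩
    have r2 := gm_rec x h hx hh 0
    have r3 := gm_rec x h hx hh 1
    have r4 := gm_rec x h hx hh 2
    simp only [zero_add, Nat.reduceAdd] at r2 r3 r4 ⊢
    rw [gm_zero x h hx hh, gm_one x h hx hh] at r2
    rw [r2, gm_one x h hx hh] at r3
    rw [r3, r2] at r4
    push_cast at r3 r4
    have hh2 : 0 < h ^ 2 := by positivity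
    have f3 : Egamma x h (fun u => (u - x) ^ 3) = (6 * h + 5 * x) * h ^ 2 := by rw [r3]; ring
    have f4 : Egamma x h (fun u => (u - x) ^ 4)
        = (4 * h * (6 * h + 5 * x) + 3 * x * (2 * h + x)) * h ^ 2 := by rw [r4]; ring
    have b1 : 6 * h + 5 * x ≤ 6 + 5 * x := by linarith
    have b2 : 4 * h * (6 * h + 5 * x) ≤ 4 * (6 + 5 * x) := by
      have : h * (6 * h + 5 * x) ≤ 1 * (6 + 5 * x) := by gcongr
      linarith
    have b3 : 3 * x * (2 * h + x) ≤ 3 * x * (2 + x) := by gcongr; linarith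
    rw [f3, f4, abs_of_nonneg (by positivity), abs_of_nonneg (by positivity)]
    constructor
    · refine mul_le_mul_of_nonneg_right ?_ hh2.le
      have : 0 ≤ 4 * (6 + 5 * x) + 3 * x * (2 + x) := by positivity
      linarith
    · refine mul_le_mul_of_nonneg_right ?_ hh2.le
      linarith
  | succ n ih =>
    obtain ⟨C, hC, H⟩ := ih
    refine ⟨C + ((n + 5) * C + (n + 4) * x * C), by positivity, fun h hh h1 => ?_⟩
    obtain ⟨A, B⟩ := H h hh h1
    have r := gm_rec x h hx hh (n + 3)
    rw [show n + 1 + 3 = n + 4 by ring, show n + 1 + 4 = n + 3 + 2 by ring, r]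
    rw [show n + 3 + 1 = n + 4 by ring]
    have hp : 0 ≤ ((n + 5) * C + (n + 4) * x * C) * h ^ 2 := by positivity
    have hc : 0 ≤ C * h ^ 2 := by positivity
    refine ⟨by linarith, ?_⟩
    rw [abs_mul, abs_of_pos hh]
    push_cast
    set a := Egamma x h (fun u => (u - x) ^ (n + 4))
    set b := Egamma x h (fun u => (u - x) ^ (n + 3))
    have : |((n : ℝ) + 3 + 2) * a + (n + 3 + 1) * x * b|
        ≤ ((n + 5) * C + (n + 4) * x * C) * h ^ 2 := by
      refine (abs_add_le _ _).trans ?_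
      rw [abs_mul, abs_mul ((n + 3 + 1 : ℝ) * x), abs_of_nonneg (by positivity : (0:ℝ) ≤ n + 3 + 2),
        abs_of_nonneg (by positivity : (0:ℝ) ≤ (n + 3 + 1) * x)]
      have t1 : ((n : ℝ) + 3 + 2) * |a| ≤ (n + 3 + 2) * (C * h ^ 2) := by gcongr
      have t2 : ((n : ℝ) + 3 + 1) * x * |b| ≤ (n + 3 + 1) * x * (C * h ^ 2) := by gcongr
      linarith
    have t := mul_le_mul h1.le this (abs_nonneg _) zero_le_one
    linarith

/-- For every `x ≥ 0` and integer `l ≥ 3`, `E[(ξ_{x,h} − x)^l] = O(h²)` as `h → 0⁺`. -/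
theorem gamma_centered_moment_higher (x : ℝ) (hx : 0 ≤ x) (l : ℕ) (hl : 3 ≤ l) :
    ∃ C > 0, ∃ h₀ > 0, ∀ h : ℝ, 0 < h → h < h₀ →
      |Egamma x h (fun u => (u - x) ^ l)| ≤ C * h ^ 2 := by
  obtain ⟨n, rfl⟩ := Nat.exists_eq_add_of_le' hl
  obtain ⟨C, hC, H⟩ := gm_bound x hx n
  exact ⟨C, hC, 1, one_pos, fun h hh h1 => (H h hh h1).1⟩
end

section
/- Let x > 0 and let p be C⁴-bounded on (0,∞). Then α₀(x,h) := E[p(ξ_{x,h})] satisfies α₀(x,h) = p(x) + p'(x) h + (p''(x)/2)(x h + 2h²) + O(h²) as h → 0⁺. -/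
open Real Filter Set MeasureTheory

/-- A function is C⁴-bounded on `(0,∞)` if it is four times continuously differentiable
there and it, together with its first four derivatives, is bounded there. -/
def C4Bounded (p : ℝ → ℝ) : Prop :=
  ContDiffOn ℝ 4 p (Set.Ioi 0) ∧
    ∀ k : ℕ, k ≤ 4 → ∃ C, ∀ u ∈ Set.Ioi (0:ℝ),
      |iteratedDerivWithin k p (Set.Ioi 0) u| ≤ C


lemma gk_moment (x h : ℝ) (hx : 0 < x) (hh : 0 < h) (k : ℕ) :
    IntegrableOn (fun u => u ^ k * gammaKernel (x / h + 1) h u) (Ioi 0) ∧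
    ∫ u in Ioi (0:ℝ), u ^ k * gammaKernel (x / h + 1) h u =
      h ^ k * Real.Gamma (x / h + 1 + k) / Real.Gamma (x / h + 1) := by
  have hxh : 0 < x / h := div_pos hx hh
  have hG : 0 < Real.Gamma (x / h + 1) := Real.Gamma_pos_of_pos (by linarith)
  have hpow : 0 < h ^ (x / h + 1) := Real.rpow_pos_of_pos hh _
  have key : ∀ u ∈ Ioi (0:ℝ), u ^ k * gammaKernel (x / h + 1) h u =
      (h ^ (x / h + 1) * Real.Gamma (x / h + 1))⁻¹ *
        (u ^ ((x / h + 1 + k) - 1) * Real.exp (-((1 / h) * u))) := by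
    intro u hu
    have hu : (0:ℝ) < u := hu
    rw [gammaKernel, show x / h + 1 + k - 1 = (x / h + 1 - 1) + k by ring,
      Real.rpow_add_natCast hu.ne', show -u / h = -((1 / h) * u) by ring]
    ring
  constructor
  · refine IntegrableOn.congr_fun ?_ (fun u hu => (key u hu).symm) measurableSet_Ioi
    refine Integrable.const_mul ?_ _
    have := integrableOn_rpow_mul_exp_neg_mul_rpow (s := x / h + 1 + k - 1) (p := 1)
      (b := 1 / h) (by have : (0:ℝ) ≤ k := k.cast_nonneg
                       linarith) (by norm_num) (by positivity)
    simpa [IntegrableOn] using this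
  · rw [setIntegral_congr_fun measurableSet_Ioi key, integral_const_mul,
      Real.integral_rpow_mul_exp_neg_mul_Ioi (by positivity) (by positivity)]
    rw [one_div_one_div, Real.rpow_add_natCast hh.ne']
    field_simp

lemma gk_rec (x h : ℝ) (hx : 0 < x) (hh : 0 < h) (k : ℕ) :
    h ^ (k+1) * Real.Gamma (x / h + 1 + (k+1 : ℕ)) / Real.Gamma (x / h + 1) =
    (x + (k + 1) * h) * (h ^ k * Real.Gamma (x / h + 1 + k) / Real.Gamma (x / h + 1)) := by
  have hxh : 0 < x / h := div_pos hx hh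
  have : x / h + 1 + k ≠ 0 := by positivity
  push_cast
  rw [← add_assoc, Real.Gamma_add_one this]
  field_simp
  ring

lemma gk_poly (x h : ℝ) (hx : 0 < x) (hh : 0 < h) (c0 c1 c2 c3 c4 : ℝ) :
    IntegrableOn (fun u => (c0 + c1 * (u - x) + c2 * (u - x)^2 + c3 * (u-x)^3 + c4 * (u-x)^4)
      * gammaKernel (x / h + 1) h u) (Ioi 0) ∧
    ∫ u in Ioi (0:ℝ), (c0 + c1 * (u - x) + c2 * (u - x)^2 + c3 * (u-x)^3 + c4 * (u-x)^4)
      * gammaKernel (x / h + 1) h u =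
      c0 + c1 * h + c2 * (x * h + 2 * h^2) + c3 * (5 * x * h^2 + 6 * h^3)
       + c4 * (3 * x^2 * h^2 + 26 * x * h^3 + 24 * h^4) := by
  have hxh : 0 < x / h := div_pos hx hh
  have hG : 0 < Real.Gamma (x / h + 1) := Real.Gamma_pos_of_pos (by linarith)
  set K := gammaKernel (x / h + 1) h with hK
  obtain ⟨i0, m0⟩ := gk_moment x h hx hh 0
  obtain ⟨i1, m1⟩ := gk_moment x h hx hh 1
  obtain ⟨i2, m2⟩ := gk_moment x h hx hh 2
  obtain ⟨i3, m3⟩ := gk_moment x h hx hh 3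
  obtain ⟨i4, m4⟩ := gk_moment x h hx hh 4
  rw [gk_rec x h hx hh, ← m3] at m4
  rw [gk_rec x h hx hh, ← m2] at m3
  rw [gk_rec x h hx hh, ← m1] at m2
  rw [gk_rec x h hx hh, ← m0] at m1
  have m0' : ∫ u in Ioi (0:ℝ), u ^ 0 * K u = 1 := by
    rw [m0]; simp [hG.ne']
  rw [← hK] at *
  have e : (fun u => (c0 + c1 * (u - x) + c2 * (u - x)^2 + c3 * (u-x)^3 + c4 * (u-x)^4) * K u)
    = fun u => (c0 - c1 * x + c2 * x^2 - c3 * x^3 + c4 * x^4) * (u ^ 0 * K u)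
      + (c1 - 2 * c2 * x + 3 * c3 * x^2 - 4 * c4 * x^3) * (u ^ 1 * K u)
      + (c2 - 3 * c3 * x + 6 * c4 * x^2) * (u ^ 2 * K u)
      + (c3 - 4 * c4 * x) * (u ^ 3 * K u) + c4 * (u ^ 4 * K u) := by
    funext u; ring
  have j0 := i0.const_mul (c0 - c1 * x + c2 * x^2 - c3 * x^3 + c4 * x^4)
  have j1 := i1.const_mul (c1 - 2 * c2 * x + 3 * c3 * x^2 - 4 * c4 * x^3)
  have j2 := i2.const_mul (c2 - 3 * c3 * x + 6 * c4 * x^2)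
  have j3 := i3.const_mul (c3 - 4 * c4 * x)
  have j4 := i4.const_mul c4
  have j01 := j0.add j1
  have j012 := j01.add j2
  have j0123 := j012.add j3
  rw [e]
  refine ⟨j0123.add j4, ?_⟩
  erw [integral_add j0123 j4, integral_add j012 j3, integral_add j01 j2, integral_add j0 j1]
  simp only [integral_const_mul]
  rw [m4, m3, m2, m1, m0']
  push_cast
  ring

lemma step_bound (x : ℝ) (hx : 0 < x) (f f' : ℝ → ℝ) (C : ℝ) (n : ℕ) (hC : 0 ≤ C) (hfx : f x = 0)
    (hf : ∀ u ∈ Ioi (0:ℝ), HasDerivAt f (f' u) u)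
    (hb : ∀ u ∈ Ioi (0:ℝ), |f' u| ≤ C * |u - x| ^ n) :
    ∀ u ∈ Ioi (0:ℝ), |f u| ≤ C * |u - x| ^ (n+1) := by
  intro u hu
  have hsub : uIcc x u ⊆ Ioi 0 := by
    intro v hv
    exact lt_of_lt_of_le (lt_min hx hu) hv.1
  have := (convex_uIcc x u).norm_image_sub_le_of_norm_hasDerivWithin_le
    (f := f) (f' := f') (C := C * |u - x| ^ n)
    (fun v hv => (hf v (hsub hv)).hasDerivWithinAt)
    (fun v hv => (hb v (hsub hv)).trans (by
      gcongr ?_ * ?_ ^ _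
      exact abs_sub_left_of_mem_uIcc hv)) left_mem_uIcc right_mem_uIcc
  rw [hfx, sub_zero, Real.norm_eq_abs, Real.norm_eq_abs] at this
  rw [pow_succ, ← mul_assoc]; exact this

lemma taylor4 (x : ℝ) (hx : 0 < x) (g0 g1 g2 g3 g4 : ℝ → ℝ) (C : ℝ)
    (h0 : ∀ u ∈ Ioi (0:ℝ), HasDerivAt g0 (g1 u) u)
    (h1 : ∀ u ∈ Ioi (0:ℝ), HasDerivAt g1 (g2 u) u)
    (h2 : ∀ u ∈ Ioi (0:ℝ), HasDerivAt g2 (g3 u) u)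
    (h3 : ∀ u ∈ Ioi (0:ℝ), HasDerivAt g3 (g4 u) u)
    (hC : 0 ≤ C) (hb : ∀ u ∈ Ioi (0:ℝ), |g4 u| ≤ C) :
    ∀ u ∈ Ioi (0:ℝ), |g0 u - (g0 x + g1 x * (u - x) + g2 x / 2 * (u-x)^2 + g3 x / 6 * (u-x)^3)|
      ≤ C * |u - x| ^ 4 := by
  have d1 : ∀ u : ℝ, HasDerivAt (fun u => u - x) 1 u := fun u => (hasDerivAt_id u).sub_const x
  have b3 := step_bound x hx (fun u => g3 u - g3 x) g4 C 0 hC (by simp)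
    (fun u hu => (h3 u hu).sub_const _) (by simpa using hb)
  have b2 := step_bound x hx (fun u => g2 u - (g2 x + g3 x * (u - x))) _ C 1 hC (by simp)
    (fun u hu => (((h2 u hu).sub (((d1 u).const_mul (g3 x)).const_add (g2 x)))).congr_deriv
      (by ring)) b3
  have b1 := step_bound x hx (fun u => g1 u - (g1 x + g2 x * (u - x) + g3 x / 2 * (u - x)^2))
    _ C 2 hC (by simp)
    (fun u hu => (((h1 u hu).sub ((((d1 u).const_mul (g2 x)).const_add (g1 x)).add
      (((d1 u).pow 2).const_mul (g3 x / 2))))).congr_deriv (by push_cast; ring)) b2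
  exact step_bound x hx
    (fun u => g0 u - (g0 x + g1 x * (u - x) + g2 x / 2 * (u - x)^2 + g3 x / 6 * (u - x)^3))
    _ C 3 hC (by simp)
    (fun u hu => (((h0 u hu).sub (((((d1 u).const_mul (g1 x)).const_add (g0 x)).add
      (((d1 u).pow 2).const_mul (g2 x / 2))).add
      (((d1 u).pow 3).const_mul (g3 x / 6))))).congr_deriv (by push_cast; ring)) b1

/-- For `x > 0` and `p` C⁴-bounded on `(0,∞)`,
`α₀(x,h) = E[p(ξ_{x,h})] = p(x) + p'(x)h + (p''(x)/2)(xh + 2h²) + O(h²)` as `h → 0⁺`. -/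
theorem alpha0_expansion (x : ℝ) (hx : 0 < x) (p : ℝ → ℝ) (hp : C4Bounded p) :
    ∃ C > 0, ∃ h₀ > 0, ∀ h : ℝ, 0 < h → h < h₀ →
      |Egamma x h p -
        (p x + iteratedDerivWithin 1 p (Set.Ioi 0) x * h +
          iteratedDerivWithin 2 p (Set.Ioi 0) x / 2 * (x * h + 2 * h ^ 2))| ≤ C * h ^ 2 := by
  obtain ⟨hcd, hbd⟩ := hp
  have hder : ∀ k : ℕ, k < 4 → ∀ u ∈ Ioi (0:ℝ),
      HasDerivAt (iteratedDerivWithin k p (Ioi 0)) (iteratedDerivWithin (k+1) p (Ioi 0) u) u := by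
    intro k hk u hu
    have hd := (hcd.differentiableOn_iteratedDerivWithin (m := k) (by exact_mod_cast hk)
      (uniqueDiffOn_Ioi 0)) u hu
    rw [iteratedDerivWithin_succ]
    exact hd.hasDerivWithinAt.hasDerivAt (Ioi_mem_nhds hu)
  obtain ⟨C0, hC0⟩ := hbd 0 (by norm_num)
  obtain ⟨C4, hC4⟩ := hbd 4 le_rfl
  have hC4n : 0 ≤ C4 := (abs_nonneg _).trans (hC4 x hx)
  have hT := taylor4 x hx _ _ _ _ _ C4 (hder 0 (by norm_num)) (hder 1 (by norm_num))
    (hder 2 (by norm_num)) (hder 3 (by norm_num)) hC4n hC4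
  simp only [iteratedDerivWithin_zero, zero_add, Nat.reduceAdd] at hT hC0
  set a := iteratedDerivWithin 1 p (Ioi 0) x
  set b := iteratedDerivWithin 2 p (Ioi 0) x
  set c := iteratedDerivWithin 3 p (Ioi 0) x
  refine ⟨|c / 6| * (5 * x + 6) + C4 * (3 * x^2 + 26 * x + 24) + 1, by positivity, 1, one_pos, ?_⟩
  intro h hh h1
  have hK : ∀ u ∈ Ioi (0:ℝ), 0 ≤ gammaKernel (x / h + 1) h u := by
    intro u hu
    have hu : (0:ℝ) < u := hu
    have hG : 0 < Real.Gamma (x / h + 1) := Real.Gamma_pos_of_pos (by positivity)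
    unfold gammaKernel
    positivity
  obtain ⟨iT, mT⟩ := gk_poly x h hx hh (p x) a (b/2) (c/6) 0
  obtain ⟨iR, mR⟩ := gk_poly x h hx hh 0 0 0 0 C4
  obtain ⟨i1, -⟩ := gk_poly x h hx hh 1 0 0 0 0
  have iP : IntegrableOn (fun u => p u * gammaKernel (x / h + 1) h u) (Ioi 0) := by
    refine Integrable.bdd_mul (c := C0) (by simpa [IntegrableOn] using i1) ?_ ?_
    · exact hcd.continuousOn.aestronglyMeasurable measurableSet_Ioi
    · exact (ae_restrict_iff' measurableSet_Ioi).2 (ae_of_all _ hC0)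
  have hmain : |Egamma x h p - ∫ u in Ioi (0:ℝ),
      (p x + a * (u - x) + b/2 * (u - x)^2 + c/6 * (u-x)^3 + 0 * (u-x)^4)
        * gammaKernel (x / h + 1) h u| ≤ C4 * (3 * x^2 * h^2 + 26 * x * h^3 + 24 * h^4) := by
    rw [Egamma, ← integral_sub iP iT]
    rw [← Real.norm_eq_abs]
    have mR' : ∫ u in Ioi (0:ℝ), (0 + 0 * (u - x) + 0 * (u - x)^2 + 0 * (u-x)^3 + C4 * (u-x)^4)
        * gammaKernel (x / h + 1) h u = C4 * (3 * x^2 * h^2 + 26 * x * h^3 + 24 * h^4) := by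
      rw [mR]; ring
    rw [← mR']
    refine norm_integral_le_of_norm_le iR ?_
    refine (ae_restrict_iff' measurableSet_Ioi).2 (ae_of_all _ fun u hu => ?_)
    rw [← sub_mul, norm_mul, Real.norm_eq_abs, Real.norm_eq_abs, abs_of_nonneg (hK u hu)]
    refine mul_le_mul_of_nonneg_right ?_ (hK u hu)
    have := hT u hu
    rw [show |u - x| ^ 4 = (u - x)^4 from Even.pow_abs (by decide) _] at this
    simpa using this
  rw [mT] at hmain
  have h2 : 0 ≤ h^2 := by positivity
  have h3 : h^3 ≤ h^2 := pow_le_pow_of_le_one hh.le h1.le (by norm_num)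
  have h4 : h^4 ≤ h^2 := pow_le_pow_of_le_one hh.le h1.le (by norm_num)
  have e1 : C4 * (3 * x^2 * h^2 + 26 * x * h^3 + 24 * h^4) ≤
      C4 * (3 * x^2 + 26 * x + 24) * h^2 := by
    calc _ ≤ C4 * (3 * x^2 * h^2 + 26 * x * h^2 + 24 * h^2) := by gcongr
      _ = _ := by ring
  have e2 : |c / 6 * (5 * x * h^2 + 6 * h^3)| ≤ |c / 6| * (5 * x + 6) * h^2 := by
    rw [abs_mul, abs_of_nonneg (a := 5 * x * h^2 + 6 * h^3) (by positivity)]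
    calc _ ≤ |c / 6| * (5 * x * h^2 + 6 * h^2) := by gcongr
      _ = _ := by ring
  rw [abs_le] at *
  constructor <;> nlinarith [hmain.1, hmain.2, e2.1, e2.2]
end

section
/- Let x > 0 and let p be C⁴-bounded on (0,∞). Then α₁(x,h) := E[(ξ_{x,h} − x) p(ξ_{x,h})] satisfies α₁(x,h) = p(x) h + p'(x)(x h + 2h²) + O(h²) as h → 0⁺. -/
open Real Filter Set MeasureTheory

theorem aux_mvt (x M : ℝ) (hx : 0 < x) (hM : 0 ≤ M) (n : ℕ) (g g' : ℝ → ℝ) (g0 : g x = 0)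
    (hg : ∀ u ∈ Ioi (0:ℝ), HasDerivAt g (g' u) u)
    (hb : ∀ u ∈ Ioi (0:ℝ), |g' u| ≤ M * |u - x| ^ n) :
    ∀ v ∈ Ioi (0:ℝ), |g v| ≤ M * |v - x| ^ (n + 1) := by
  intro v hv
  have hv' : 0 < v := hv
  have hpos : ∀ u ∈ uIcc x v, u ∈ Ioi (0:ℝ) := fun u hu =>
    lt_of_lt_of_le (lt_min hx hv') hu.1
  have key := Convex.norm_image_sub_le_of_norm_hasDerivWithin_le (f := g) (f' := g')
    (s := uIcc x v) (x := x) (y := v) (C := M * |v - x| ^ n)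
    (fun u hu => (hg u (hpos u hu)).hasDerivWithinAt)
    (fun u hu => (hb u (hpos u hu)).trans (by
      have h1 : |u - x| ≤ |v - x| := abs_sub_left_of_mem_uIcc hu
      gcongr)) (convex_uIcc x v) left_mem_uIcc right_mem_uIcc
  simp only [g0, sub_zero, Real.norm_eq_abs] at key
  rw [pow_succ, ← mul_assoc]
  exact key

theorem aux_hasDeriv (p : ℝ → ℝ) (hp : ContDiffOn ℝ 4 p (Ioi 0)) (k : ℕ) (hk : k < 4) :
    ∀ u ∈ Ioi (0:ℝ), HasDerivAt (iteratedDerivWithin k p (Ioi 0))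
      (iteratedDerivWithin (k + 1) p (Ioi 0) u) u := by
  intro u hu
  have hd : DifferentiableOn ℝ (iteratedDerivWithin k p (Ioi 0)) (Ioi 0) :=
    hp.differentiableOn_iteratedDerivWithin (by exact_mod_cast hk) (uniqueDiffOn_Ioi 0)
  have h1 := (hd u hu).hasDerivWithinAt
  rw [← iteratedDerivWithin_succ] at h1
  exact h1.hasDerivAt (Ioi_mem_nhds hu)

theorem aux_taylor (x : ℝ) (hx : 0 < x) (p : ℝ → ℝ) (hp : C4Bounded p) :
    ∃ d M : ℝ, 0 ≤ M ∧ ∀ u ∈ Ioi (0:ℝ),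
      |p u - (p x + iteratedDerivWithin 1 p (Ioi 0) x * (u - x) + d * (u - x) ^ 2)|
        ≤ M * |u - x| ^ 3 := by
  obtain ⟨hc, hb⟩ := hp
  obtain ⟨M, hM⟩ := hb 3 (by norm_num)
  have hM0 : 0 ≤ M := (abs_nonneg _).trans (hM x hx)
  have D0 := aux_hasDeriv p hc 0 (by norm_num)
  have D1 := aux_hasDeriv p hc 1 (by norm_num)
  have D2 := aux_hasDeriv p hc 2 (by norm_num)
  simp only [iteratedDerivWithin_zero, zero_add, Nat.reduceAdd] at D0 D1 D2
  set d1 := iteratedDerivWithin 1 p (Ioi 0)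
  set d2 := iteratedDerivWithin 2 p (Ioi 0)
  set d3 := iteratedDerivWithin 3 p (Ioi 0)
  have B2 := aux_mvt x M hx hM0 0 (fun u => d2 u - d2 x) d3 (by simp)
    (fun u hu => (D2 u hu).sub_const _) (fun u hu => by simpa using hM u hu)
  have B1 := aux_mvt x M hx hM0 1 (fun u => d1 u - (d1 x + d2 x * (u - x)))
    (fun u => d2 u - d2 x) (by simp)
    (fun u hu => by
      have := (D1 u hu).sub ((((hasDerivAt_id u).sub_const x).const_mul (d2 x)).const_add (d1 x))
      exact this.congr_deriv (by simp)) B2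
  have B0 := aux_mvt x M hx hM0 2 (fun u => p u - (p x + d1 x * (u - x) + d2 x / 2 * (u - x) ^ 2))
    (fun u => d1 u - (d1 x + d2 x * (u - x))) (by simp)
    (fun u hu => by
      have e := (hasDerivAt_id u).sub_const x
      have := (D0 u hu).sub (((e.const_mul (d1 x)).const_add (p x)).add
        ((e.pow 2).const_mul (d2 x / 2)))
      exact this.congr_deriv (by simp; ring)) B1
  exact ⟨d2 x / 2, M, hM0, B0⟩

theorem aux_K (a h : ℝ) (ha : 0 < a) (hh : 0 < h) :
    IntegrableOn (gammaKernel a h) (Ioi 0) ∧ ∫ u in Ioi (0:ℝ), gammaKernel a h u = 1 := by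
  have hG := Real.Gamma_pos_of_pos ha
  have hI := Real.integral_rpow_mul_exp_neg_mul_Ioi ha (inv_pos.2 hh)
  have e : gammaKernel a h = fun u => u ^ (a - 1) * Real.exp (-(h⁻¹ * u)) / (h ^ a * Real.Gamma a) := by
    funext u
    unfold gammaKernel
    congr 3
    field_simp
  have h1 : ∫ u in Ioi (0:ℝ), gammaKernel a h u = 1 := by
    rw [e, integral_div, hI]
    simp only [one_div, inv_inv]
    have : 0 < h ^ a := Real.rpow_pos_of_pos hh a
    field_simp
  refine ⟨?_, h1⟩
  by_contra hn
  rw [integral_undef hn] at h1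
  exact zero_ne_one h1

theorem aux_K_succ (a h u : ℝ) (ha : 0 < a) (hh : 0 < h) (hu : 0 < u) :
    u * gammaKernel a h u = (h * a) * gammaKernel (a + 1) h u := by
  unfold gammaKernel
  have hG := Real.Gamma_pos_of_pos ha
  have : 0 < h ^ a := Real.rpow_pos_of_pos hh a
  rw [Real.Gamma_add_one ha.ne', Real.rpow_add_one hh.ne',
    show a + 1 - 1 = (a - 1) + 1 by ring, Real.rpow_add_one hu.ne']
  field_simp

theorem aux_moment_succ (a h m : ℝ) (ha : 0 < a) (hh : 0 < h) (k : ℕ)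
    (H : IntegrableOn (fun u => u ^ k * gammaKernel (a + 1) h u) (Ioi 0) ∧
      ∫ u in Ioi (0:ℝ), u ^ k * gammaKernel (a + 1) h u = m) :
    IntegrableOn (fun u => u ^ (k + 1) * gammaKernel a h u) (Ioi 0) ∧
      ∫ u in Ioi (0:ℝ), u ^ (k + 1) * gammaKernel a h u = h * a * m := by
  have e : EqOn (fun u => (h * a) * (u ^ k * gammaKernel (a + 1) h u))
      (fun u => u ^ (k + 1) * gammaKernel a h u) (Ioi 0) := by
    intro u hu
    have := aux_K_succ a h u ha hh hu
    simp only
    linear_combination (-u ^ k) * this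
  refine ⟨IntegrableOn.congr_fun (H.1.const_mul (h * a)) e measurableSet_Ioi, ?_⟩
  rw [← setIntegral_congr_fun measurableSet_Ioi e, integral_const_mul, H.2]

theorem aux_moment (k : ℕ) : ∀ (a h : ℝ), 0 < a → 0 < h →
    IntegrableOn (fun u => u ^ k * gammaKernel a h u) (Ioi 0) ∧
      ∫ u in Ioi (0:ℝ), u ^ k * gammaKernel a h u
        = ∏ i ∈ Finset.range k, (h * (a + i)) := by
  induction k with
  | zero => intro a h ha hh; simpa using aux_K a h ha hh
  | succ k ih =>
    intro a h ha hh
    have := aux_moment_succ a h _ ha hh k (ih (a + 1) h (by linarith) hh)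
    rw [Finset.prod_range_succ']
    refine ⟨this.1, this.2.trans ?_⟩
    rw [mul_comm]
    congr 1
    · apply Finset.prod_congr rfl
      intro i _
      push_cast
      ring
    · simp

theorem aux_poly (x h : ℝ) (hx : 0 < x) (hh : 0 < h) (c0 c1 c2 c3 c4 : ℝ) :
    IntegrableOn (fun u => (c0 + c1 * u + c2 * u ^ 2 + c3 * u ^ 3 + c4 * u ^ 4)
        * gammaKernel (x / h + 1) h u) (Ioi 0) ∧
      ∫ u in Ioi (0:ℝ), (c0 + c1 * u + c2 * u ^ 2 + c3 * u ^ 3 + c4 * u ^ 4)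
        * gammaKernel (x / h + 1) h u
        = c0 + c1 * (x + h) + c2 * ((x + h) * (x + 2 * h))
          + c3 * ((x + h) * (x + 2 * h) * (x + 3 * h))
          + c4 * ((x + h) * (x + 2 * h) * (x + 3 * h) * (x + 4 * h)) := by
  have ha : 0 < x / h + 1 := by positivity
  have hm : ∀ t : ℝ, h * (x / h + 1 + t) = x + (1 + t) * h := by
    intro t; field_simp; ring
  have m := fun k => aux_moment k (x / h + 1) h ha hh
  obtain ⟨i0, e0⟩ := m 0
  obtain ⟨i1, e1⟩ := m 1
  obtain ⟨i2, e2⟩ := m 2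
  obtain ⟨i3, e3⟩ := m 3
  obtain ⟨i4, e4⟩ := m 4
  simp only [Finset.prod_range_succ, Finset.prod_range_zero, hm] at e0 e1 e2 e3 e4
  set K := gammaKernel (x / h + 1) h
  have e : (fun u => (c0 + c1 * u + c2 * u ^ 2 + c3 * u ^ 3 + c4 * u ^ 4) * K u) =
      fun u => c0 * (u ^ 0 * K u) + c1 * (u ^ 1 * K u) + c2 * (u ^ 2 * K u)
        + c3 * (u ^ 3 * K u) + c4 * (u ^ 4 * K u) := by
    funext u; ring
  have j0 := i0.const_mul c0
  have j1 := i1.const_mul c1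
  have j2 := i2.const_mul c2
  have j3 := i3.const_mul c3
  have j4 := i4.const_mul c4
  rw [e]
  have k1 := j0.fun_add j1
  have k2 := k1.fun_add j2
  have k3 := k2.fun_add j3
  refine ⟨k3.fun_add j4, ?_⟩
  rw [integral_add k3 j4, integral_add k2 j3, integral_add k1 j2, integral_add j0 j1]
  simp only [integral_const_mul, e0, e1, e2, e3, e4]
  push_cast
  ring

/-- For `x > 0` and `p` C⁴-bounded on `(0,∞)`,
`α₁(x,h) = E[(ξ_{x,h} − x) p(ξ_{x,h})] = p(x)h + p'(x)(xh + 2h²) + O(h²)` as `h → 0⁺`. -/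
theorem alpha1_expansion (x : ℝ) (hx : 0 < x) (p : ℝ → ℝ) (hp : C4Bounded p) :
    ∃ C > 0, ∃ h₀ > 0, ∀ h : ℝ, 0 < h → h < h₀ →
      |Egamma x h (fun u => (u - x) * p u) -
        (p x * h + iteratedDerivWithin 1 p (Set.Ioi 0) x * (x * h + 2 * h ^ 2))|
        ≤ C * h ^ 2 := by
  obtain ⟨d, M, hM, hT⟩ := aux_taylor x hx p hp
  have hpc : ContinuousOn p (Ioi 0) := hp.1.continuousOn
  set q := iteratedDerivWithin 1 p (Set.Ioi 0) x
  refine ⟨|d| * (5 * x + 6) + M * (3 * x ^ 2 + 26 * x + 24) + 1, by positivity, 1, one_pos, ?_⟩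
  intro h hh hh1
  -- the polynomial part
  have P1 := aux_poly x h hx hh (-(x * p x) + q * x ^ 2 - d * x ^ 3)
    (p x - 2 * q * x + 3 * d * x ^ 2) (q - 3 * d * x) d 0
  have P2 := aux_poly x h hx hh (M * x ^ 4) (M * (-4 * x ^ 3)) (M * (6 * x ^ 2)) (M * (-4 * x)) M
  have hKnn : ∀ u ∈ Ioi (0:ℝ), 0 ≤ gammaKernel (x / h + 1) h u := by
    intro u hu
    have hu' : 0 < u := hu
    have := Real.Gamma_pos_of_pos (show 0 < x / h + 1 by positivity)
    unfold gammaKernel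
    positivity
  have hKm : AEStronglyMeasurable (gammaKernel (x / h + 1) h) (volume.restrict (Ioi 0)) :=
    (aux_K (x / h + 1) h (by positivity) hh).1.aestronglyMeasurable
  unfold Egamma
  set K := gammaKernel (x / h + 1) h
  set P : ℝ → ℝ := fun u => ((-(x * p x) + q * x ^ 2 - d * x ^ 3)
    + (p x - 2 * q * x + 3 * d * x ^ 2) * u + (q - 3 * d * x) * u ^ 2 + d * u ^ 3 + 0 * u ^ 4) * K u
  set Q : ℝ → ℝ := fun u => (M * x ^ 4 + M * (-4 * x ^ 3) * u + M * (6 * x ^ 2) * u ^ 2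
    + M * (-4 * x) * u ^ 3 + M * u ^ 4) * K u
  set R : ℝ → ℝ := fun u => (u - x) * p u * K u - P u
  have hRb : ∀ u ∈ Ioi (0:ℝ), ‖R u‖ ≤ Q u := by
    intro u hu
    have e1 : R u = (u - x) * (p u - (p x + q * (u - x) + d * (u - x) ^ 2)) * K u := by
      simp only [R, P]; ring
    have e2 : Q u = |u - x| * (M * |u - x| ^ 3) * K u := by
      have : |u - x| * (M * |u - x| ^ 3) = M * (|u - x| ^ 2) ^ 2 := by ring
      rw [this, sq_abs]; simp only [Q]; ring
    rw [e1, e2, Real.norm_eq_abs, abs_mul, abs_mul, abs_of_nonneg (hKnn u hu)]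
    have h1 := hT u hu
    have h2 := hKnn u hu
    gcongr
  have hfm : AEStronglyMeasurable (fun u => (u - x) * p u * K u) (volume.restrict (Ioi 0)) := by
    refine AEStronglyMeasurable.mul ?_ hKm
    refine ContinuousOn.aestronglyMeasurable ?_ measurableSet_Ioi
    exact (continuousOn_id.sub continuousOn_const).mul hpc
  have hae : ∀ᵐ u ∂(volume.restrict (Ioi (0:ℝ))), ‖R u‖ ≤ Q u :=
    (ae_restrict_mem measurableSet_Ioi).mono hRb
  have hRi : IntegrableOn R (Ioi 0) :=
    P2.1.mono' (hfm.sub P1.1.aestronglyMeasurable) hae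
  have hRint := norm_integral_le_of_norm_le P2.1 hae
  rw [P2.2] at hRint
  have hsplit : ∫ u in Ioi (0:ℝ), (u - x) * p u * K u
      = (∫ u in Ioi (0:ℝ), R u) + ∫ u in Ioi (0:ℝ), P u := by
    rw [← integral_add hRi P1.1]
    congr 1
    funext u
    simp only [R]; ring
  rw [hsplit, P1.2]
  rw [Real.norm_eq_abs] at hRint
  have hh3 : h ^ 3 ≤ h ^ 2 := pow_le_pow_of_le_one hh.le hh1.le (by norm_num)
  have hh4 : h ^ 4 ≤ h ^ 2 := pow_le_pow_of_le_one hh.le hh1.le (by norm_num)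
  have b1 : |∫ u in Ioi (0:ℝ), R u| ≤ M * (3 * x ^ 2 + 26 * x + 24) * h ^ 2 := by
    refine hRint.trans ?_
    have : M * (3 * x ^ 2 * h ^ 2 + 26 * x * h ^ 3 + 24 * h ^ 4)
        ≤ M * (3 * x ^ 2 * h ^ 2 + 26 * x * h ^ 2 + 24 * h ^ 2) := by gcongr
    linarith
  have b2 : |d * (5 * x * h ^ 2 + 6 * h ^ 3)| ≤ |d| * (5 * x + 6) * h ^ 2 := by
    rw [abs_mul, abs_of_nonneg (by positivity : 0 ≤ 5 * x * h ^ 2 + 6 * h ^ 3)]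
    have : |d| * (5 * x * h ^ 2 + 6 * h ^ 3) ≤ |d| * (5 * x * h ^ 2 + 6 * h ^ 2) := by gcongr
    linarith
  have b3 := abs_add_le (∫ u in Ioi (0:ℝ), R u) (d * (5 * x * h ^ 2 + 6 * h ^ 3))
  have b4 : 0 ≤ h ^ 2 := by positivity
  calc _ = |(∫ u in Ioi (0:ℝ), R u) + d * (5 * x * h ^ 2 + 6 * h ^ 3)| := by
        congr 1; ring
    _ ≤ _ := by linarith
end

section
/- Let x > 0, let p and g be C⁴-bounded on (0,∞) with p(x) > 0, and set β_k(x,h) = E[(ξ_{x,h} − x)^k g(ξ_{x,h}) p(ξ_{x,h})]. Then for all sufficiently small h > 0 the quantity α₀(x,h)·α₂(x,h) − α₁(x,h)² is nonzero, and (α₂(x,h)·β₂(x,h) − α₁(x,h)·β₃(x,h)) / (α₀(x,h)·α₂(x,h) − α₁(x,h)²) = g(x)·x·h + O(h²) as h → 0⁺. -/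
open Real Filter Set MeasureTheory

lemma gk_meas (α θ : ℝ) : Measurable (gammaKernel α θ) := by
  unfold gammaKernel; fun_prop

lemma gk_nonneg_s14 {α θ : ℝ} (hα : 0 < α) (hθ : 0 < θ) {u : ℝ} (hu : 0 < u) :
    0 ≤ gammaKernel α θ u := by
  unfold gammaKernel
  have := Real.Gamma_pos_of_pos hα
  positivity

lemma gk_shift {α θ : ℝ} (hα : 0 < α) (hθ : 0 < θ) {u : ℝ} (hu : 0 < u) :
    u * gammaKernel α θ u = θ * α * gammaKernel (α + 1) θ u := by
  unfold gammaKernel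
  have h1 := Real.Gamma_pos_of_pos hα
  rw [Real.Gamma_add_one hα.ne', Real.rpow_add_one hθ.ne',
    show α + 1 - 1 = (α - 1) + 1 by ring, Real.rpow_add_one hu.ne']
  have h2 := Real.rpow_pos_of_pos hθ α
  field_simp

lemma gk_moment_s14 (θ : ℝ) (hθ : 0 < θ) (k : ℕ) : ∀ α : ℝ, 0 < α →
    IntegrableOn (fun u => u ^ k * gammaKernel α θ u) (Ioi 0) ∧
    ∫ u in Ioi (0:ℝ), u ^ k * gammaKernel α θ u = ∏ i ∈ Finset.range k, (θ * (α + i)) := by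
  induction k with
  | zero =>
    intro α hα
    have h1 := Real.Gamma_pos_of_pos hα
    have h2 := Real.rpow_pos_of_pos hθ α
    have e : (fun u : ℝ => u ^ 0 * gammaKernel α θ u) =
        fun u => (u ^ (α - 1) * Real.exp (-(θ⁻¹ * u))) * (θ ^ α * Real.Gamma α)⁻¹ := by
      funext u
      unfold gammaKernel
      rw [show -u / θ = -(θ⁻¹ * u) by ring]
      ring
    have hi := Real.integral_rpow_mul_exp_neg_mul_Ioi hα (inv_pos.2 hθ)
    have h3 : (∫ u in Ioi (0:ℝ), u ^ 0 * gammaKernel α θ u) = 1 := by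
      rw [e, integral_mul_const, hi]
      simp only [one_div, inv_inv]
      field_simp
    constructor
    · by_contra hc
      rw [integral_undef hc] at h3
      norm_num at h3
    · simpa using h3
  | succ k ih =>
    intro α hα
    obtain ⟨i1, i2⟩ := ih (α + 1) (by linarith)
    have e : EqOn (fun u : ℝ => u ^ (k+1) * gammaKernel α θ u)
        (fun u => (θ * α) * (u ^ k * gammaKernel (α + 1) θ u)) (Ioi 0) := by
      intro u hu
      have := gk_shift hα hθ hu
      simp only
      rw [pow_succ, mul_assoc, this]; ring
    constructor
    · rw [integrableOn_congr_fun e measurableSet_Ioi]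
      exact i1.const_mul _
    · rw [setIntegral_congr_fun measurableSet_Ioi e, integral_const_mul, i2,
        Finset.prod_range_succ']
      rw [mul_comm]
      congr 1
      · apply Finset.prod_congr rfl
        intro i _
        push_cast; ring
      · simp

lemma E_poly (x h : ℝ) (hx : 0 < x) (hh : 0 < h) (a b c d e : ℝ) :
    IntegrableOn (fun u => (a + b * (u - x) + c * (u - x) ^ 2 + d * (u - x) ^ 3 + e * (u - x) ^ 4)
      * gammaKernel (x / h + 1) h u) (Ioi 0) ∧
    Egamma x h (fun u => a + b * (u - x) + c * (u - x) ^ 2 + d * (u - x) ^ 3 + e * (u - x) ^ 4)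
      = a + b * h + c * (x * h + 2 * h ^ 2) + d * (5 * x * h ^ 2 + 6 * h ^ 3)
        + e * (3 * x ^ 2 * h ^ 2 + 26 * x * h ^ 3 + 24 * h ^ 4) := by
  have hα : 0 < x / h + 1 := by positivity
  have M := fun k => gk_moment_s14 h hh k (x / h + 1) hα
  set K := gammaKernel (x / h + 1) h
  have eq : (fun u => (a + b * (u - x) + c * (u - x) ^ 2 + d * (u - x) ^ 3 + e * (u - x) ^ 4) * K u)
      = fun u => (a - b * x + c * x ^ 2 - d * x ^ 3 + e * x ^ 4) * (u ^ 0 * K u)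
       + (b - 2 * c * x + 3 * d * x ^ 2 - 4 * e * x ^ 3) * (u ^ 1 * K u)
       + (c - 3 * d * x + 6 * e * x ^ 2) * (u ^ 2 * K u)
       + (d - 4 * e * x) * (u ^ 3 * K u) + e * (u ^ 4 * K u) := by
    funext u; ring
  have I := fun (k : ℕ) (t : ℝ) => ((M k).1.const_mul t)
  unfold Egamma
  simp only [show gammaKernel (x / h + 1) h = K from rfl]
  rw [eq]
  have I1 := (I 0 (a - b * x + c * x ^ 2 - d * x ^ 3 + e * x ^ 4)).add
    (I 1 (b - 2 * c * x + 3 * d * x ^ 2 - 4 * e * x ^ 3))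
  have I2 := I1.add (I 2 (c - 3 * d * x + 6 * e * x ^ 2))
  have I3 := I2.add (I 3 (d - 4 * e * x))
  refine ⟨I3.add (I 4 e), ?_⟩
  refine (integral_add I3 (I 4 e)).trans ?_
  rw [integral_add' I2 (I 3 _), integral_add' I1 (I 2 _), integral_add' (I 0 _) (I 1 _)]
  simp only [integral_const_mul, (M _).2]
  simp only [Finset.prod_range_succ, Finset.prod_range_zero]
  push_cast
  field_simp
  ring

lemma E_close (x h : ℝ) (hx : 0 < x) (hh : 0 < h) (a b c d e c' e' : ℝ) (f : ℝ → ℝ)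
    (hf : ContinuousOn f (Ioi 0))
    (hb : ∀ u ∈ Ioi (0:ℝ), |f u - (a + b * (u - x) + c * (u - x) ^ 2 + d * (u - x) ^ 3
      + e * (u - x) ^ 4)| ≤ c' * (u - x) ^ 2 + e' * (u - x) ^ 4) :
    |Egamma x h f - (a + b * h + c * (x * h + 2 * h ^ 2) + d * (5 * x * h ^ 2 + 6 * h ^ 3)
        + e * (3 * x ^ 2 * h ^ 2 + 26 * x * h ^ 3 + 24 * h ^ 4))| ≤
      c' * (x * h + 2 * h ^ 2) + e' * (3 * x ^ 2 * h ^ 2 + 26 * x * h ^ 3 + 24 * h ^ 4) := by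
  have hα : 0 < x / h + 1 := by positivity
  obtain ⟨i1, v1⟩ := E_poly x h hx hh a b c d e
  obtain ⟨i2, v2⟩ := E_poly x h hx hh 0 0 c' 0 e'
  rw [← v1]
  have v3 : c' * (x * h + 2 * h ^ 2) + e' * (3 * x ^ 2 * h ^ 2 + 26 * x * h ^ 3 + 24 * h ^ 4)
    = Egamma x h (fun u => 0 + 0 * (u - x) + c' * (u - x) ^ 2 + 0 * (u - x) ^ 3 + e' * (u - x) ^ 4) := by
    rw [v2]; ring
  rw [v3]
  unfold Egamma at *
  set K := gammaKernel (x / h + 1) h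
  set P : ℝ → ℝ := fun u => a + b * (u - x) + c * (u - x) ^ 2 + d * (u - x) ^ 3 + e * (u - x) ^ 4 with hP
  have bd : ∀ u ∈ Ioi (0:ℝ), ‖f u * K u - P u * K u‖ ≤
      (0 + 0 * (u - x) + c' * (u - x) ^ 2 + 0 * (u - x) ^ 3 + e' * (u - x) ^ 4) * K u := by
    intro u hu
    have k0 : 0 ≤ K u := gk_nonneg_s14 hα hh hu
    rw [← sub_mul, Real.norm_eq_abs, abs_mul, abs_of_nonneg k0]
    apply mul_le_mul_of_nonneg_right _ k0
    have := hb u hu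
    simp only [hP]; linarith
  have bd' := (ae_restrict_iff' (μ := volume) measurableSet_Ioi).2 (Eventually.of_forall bd)
  have hm : AEStronglyMeasurable (fun u => f u * K u) (volume.restrict (Ioi 0)) :=
    (hf.aestronglyMeasurable measurableSet_Ioi).mul (gk_meas _ _).aestronglyMeasurable
  have id : IntegrableOn (fun u => f u * K u - P u * K u) (Ioi 0) :=
    Integrable.mono' i2 (hm.sub i1.aestronglyMeasurable) bd'
  have i3 : IntegrableOn (fun u => f u * K u) (Ioi 0) := by
    have := id.add i1
    refine this.congr (Eventually.of_forall fun u => ?_)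
    simp [hP]
  rw [← integral_sub i3 i1]
  exact norm_integral_le_of_norm_le i2 bd'

/-- first-order Taylor data. -/
lemma taylor_data (x : ℝ) (hx : 0 < x) (p : ℝ → ℝ) (hp : C4Bounded p) :
    ContinuousOn p (Ioi 0) ∧ ∃ p1 B L M : ℝ, (∀ u ∈ Ioi (0:ℝ), |p u| ≤ B) ∧
      (∀ u ∈ Ioi (0:ℝ), |p u - p x| ≤ L * |u - x|) ∧
      (∀ u ∈ Ioi (0:ℝ), |p u - p x - p1 * (u - x)| ≤ M * (u - x) ^ 2) := by
  obtain ⟨hc, hb⟩ := hp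
  obtain ⟨B, hB⟩ := hb 0 (by norm_num)
  obtain ⟨L, hL⟩ := hb 1 (by norm_num)
  obtain ⟨M, hM⟩ := hb 2 (by norm_num)
  have us : UniqueDiffOn ℝ (Ioi (0:ℝ)) := uniqueDiffOn_Ioi 0
  have cv : Convex ℝ (Ioi (0:ℝ)) := convex_Ioi 0
  have d1 : ∀ u ∈ Ioi (0:ℝ), HasDerivWithinAt p (iteratedDerivWithin 1 p (Ioi 0) u) (Ioi 0) u := by
    intro u hu
    rw [iteratedDerivWithin_one]
    exact (hc.differentiableOn (by norm_num) u hu).hasDerivWithinAt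
  have d2 : ∀ u ∈ Ioi (0:ℝ), HasDerivWithinAt (iteratedDerivWithin 1 p (Ioi 0))
      (iteratedDerivWithin 2 p (Ioi 0) u) (Ioi 0) u := by
    intro u hu
    rw [show iteratedDerivWithin 2 p (Ioi 0) = _ from iteratedDerivWithin_succ (n := 1)]
    exact (hc.differentiableOn_iteratedDerivWithin (m := 1) (by norm_num) us u hu).hasDerivWithinAt
  have l1 : ∀ u ∈ Ioi (0:ℝ), |p u - p x| ≤ L * |u - x| := fun u hu =>
    cv.norm_image_sub_le_of_norm_hasDerivWithin_le d1 hL hx hu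
  have l2 : ∀ u ∈ Ioi (0:ℝ), |iteratedDerivWithin 1 p (Ioi 0) u - iteratedDerivWithin 1 p (Ioi 0) x|
      ≤ M * |u - x| := fun u hu =>
    cv.norm_image_sub_le_of_norm_hasDerivWithin_le d2 hM hx hu
  have M0 : 0 ≤ M := (abs_nonneg _).trans (hM x hx)
  refine ⟨hc.continuousOn, iteratedDerivWithin 1 p (Ioi 0) x, B, L, M, ?_, l1, ?_⟩
  · intro u hu; simpa using hB u hu
  · intro u hu
    have sub : uIcc x u ⊆ Ioi (0:ℝ) := by
      intro t ht
      exact lt_of_lt_of_le (lt_min hx hu) ht.1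
    have := (convex_uIcc x u).norm_image_sub_le_of_norm_hasDerivWithin_le
      (f := fun t => p t - iteratedDerivWithin 1 p (Ioi 0) x * t)
      (f' := fun t => iteratedDerivWithin 1 p (Ioi 0) t - iteratedDerivWithin 1 p (Ioi 0) x)
      (C := M * |u - x|) (x := x) (y := u) ?_ ?_ left_mem_uIcc right_mem_uIcc
    · simp only [Real.norm_eq_abs] at this
      rw [show M * (u - x) ^ 2 = M * |u - x| * |u - x| by rw [mul_assoc, ← sq, sq_abs]]
      convert this using 2; ring
    · intro t ht
      have := ((d1 t (sub ht)).mono sub).sub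
        (((hasDerivWithinAt_id t (uIcc x u)).const_mul (iteratedDerivWithin 1 p (Ioi 0) x)))
      rw [mul_one] at this
      exact this
    · intro t ht
      refine (l2 t (sub ht)).trans (mul_le_mul_of_nonneg_left ?_ M0)
      exact abs_sub_left_of_mem_uIcc ht

/-- bounded on (0,1) -/
def Bd (f : ℝ → ℝ) : Prop := ∃ K, ∀ h, 0 < h → h < 1 → |f h| ≤ K

lemma Bd.add {f g : ℝ → ℝ} (hf : Bd f) (hg : Bd g) : Bd (fun h => f h + g h) := by
  obtain ⟨K, hK⟩ := hf
  obtain ⟨L, hL⟩ := hg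
  exact ⟨K + L, fun h a b => (abs_add_le _ _).trans (add_le_add (hK h a b) (hL h a b))⟩

lemma Bd.mul {f g : ℝ → ℝ} (hf : Bd f) (hg : Bd g) : Bd (fun h => f h * g h) := by
  obtain ⟨K, hK⟩ := hf
  obtain ⟨L, hL⟩ := hg
  refine ⟨K * L, fun h a b => ?_⟩
  rw [abs_mul]
  exact mul_le_mul (hK h a b) (hL h a b) (abs_nonneg _) ((abs_nonneg _).trans (hK h a b))

lemma Bd.const (c : ℝ) : Bd (fun _ => c) := ⟨|c|, fun _ _ _ => le_rfl⟩

lemma Bd.self : Bd (fun h => h) := ⟨1, fun h a b => by rw [abs_of_pos a]; exact b.le⟩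

lemma Bd.sub {f g : ℝ → ℝ} (hf : Bd f) (hg : Bd g) : Bd (fun h => f h - g h) := by
  have := hf.add ((Bd.const (-1)).mul hg)
  convert this using 2; ring

lemma Bd.of_close {F m r : ℝ → ℝ} {s : ℝ → ℝ} (hs : ∀ h, 0 < h → 0 < s h)
    (hm : Bd m) (hr : Bd r)
    (H : ∀ h, 0 < h → h < 1 → |F h - s h * m h| ≤ s h * r h) : Bd (fun h => F h / s h) := by
  obtain ⟨K, hK⟩ := hm
  obtain ⟨L, hL⟩ := hr
  refine ⟨K + L, fun h a b => ?_⟩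
  have s0 := hs h a
  have h1 := H h a b
  rw [abs_div, abs_of_pos s0, div_le_iff₀ s0]
  have h2 : |F h| ≤ |F h - s h * m h| + |s h * m h| := by
    have := abs_add_le (F h - s h * m h) (s h * m h)
    simpa using this
  rw [abs_mul, abs_of_pos s0] at h2
  have h3 := mul_le_mul_of_nonneg_left (hK h a b) s0.le
  have h4 := mul_le_mul_of_nonneg_left ((le_abs_self _).trans (hL h a b)) s0.le
  nlinarith

lemma alpha0 (x : ℝ) (hx : 0 < x) (q : ℝ → ℝ) (hc : ContinuousOn q (Ioi 0)) (q1 M : ℝ)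
    (h2 : ∀ u ∈ Ioi (0:ℝ), |q u - q x - q1 * (u - x)| ≤ M * (u - x) ^ 2) :
    Bd (fun h => (Egamma x h q - q x) / h) := by
  refine Bd.of_close (s := fun h => h) (m := fun _ => q1) (r := fun h => M * (x + 2 * h))
    (fun h a => a) (Bd.const _)
    ((Bd.const _).mul ((Bd.const _).add ((Bd.const _).mul Bd.self))) ?_
  intro h a b
  have := E_close x h hx a (q x) q1 0 0 0 M 0 q hc (by
    intro u hu
    convert h2 u hu using 1
    · congr 1; ring
    · ring)
  convert this using 1
  · congr 1; ring
  · ring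

lemma alpha1 (x : ℝ) (hx : 0 < x) (q : ℝ → ℝ) (hc : ContinuousOn q (Ioi 0)) (L : ℝ)
    (h1 : ∀ u ∈ Ioi (0:ℝ), |q u - q x| ≤ L * |u - x|) :
    Bd (fun h => (Egamma x h (fun u => (u - x) * q u)) / h) := by
  refine Bd.of_close (s := fun h => h) (m := fun _ => q x) (r := fun h => L * (x + 2 * h))
    (fun h a => a) (Bd.const _)
    ((Bd.const _).mul ((Bd.const _).add ((Bd.const _).mul Bd.self))) ?_
  intro h a b
  have := E_close x h hx a 0 (q x) 0 0 0 L 0 (fun u => (u - x) * q u)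
    ((by fun_prop : ContinuousOn (fun u : ℝ => u - x) (Ioi 0)).mul hc) (by
    intro u hu
    have : |(u - x)| * |q u - q x| ≤ |(u - x)| * (L * |u - x|) :=
      mul_le_mul_of_nonneg_left (h1 u hu) (abs_nonneg _)
    rw [← abs_mul] at this
    convert this using 1
    · congr 1; ring
    · rw [← sq_abs (u - x)]; ring)
  convert this using 1
  · congr 1; ring
  · ring

lemma alpha2 (x : ℝ) (hx : 0 < x) (q : ℝ → ℝ) (hc : ContinuousOn q (Ioi 0)) (q1 M : ℝ)
    (h2 : ∀ u ∈ Ioi (0:ℝ), |q u - q x - q1 * (u - x)| ≤ M * (u - x) ^ 2) :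
    Bd (fun h => (Egamma x h (fun u => (u - x) ^ 2 * q u) - q x * x * h) / h ^ 2) := by
  refine Bd.of_close (s := fun h => h ^ 2) (m := fun h => 2 * q x + q1 * (5 * x + 6 * h))
    (r := fun h => M * (3 * x ^ 2 + 26 * x * h + 24 * (h * h)))
    (fun h a => by positivity)
    ((Bd.const _).add ((Bd.const _).mul ((Bd.const _).add ((Bd.const _).mul Bd.self))))
    ((Bd.const _).mul (((Bd.const _).add ((Bd.const _).mul Bd.self)).add
      ((Bd.const _).mul (Bd.self.mul Bd.self)))) ?_
  intro h a b
  have := E_close x h hx a 0 0 (q x) q1 0 0 M (fun u => (u - x) ^ 2 * q u)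
    ((by fun_prop : ContinuousOn (fun u : ℝ => (u - x) ^ 2) (Ioi 0)).mul hc) (by
    intro u hu
    have : |(u - x) ^ 2| * |q u - q x - q1 * (u - x)| ≤ |(u - x) ^ 2| * (M * (u - x) ^ 2) :=
      mul_le_mul_of_nonneg_left (h2 u hu) (abs_nonneg _)
    rw [← abs_mul] at this
    convert this using 1
    · congr 1; ring
    · rw [abs_of_nonneg (sq_nonneg _)]; ring)
  convert this using 1
  · congr 1; ring
  · ring

lemma alpha3 (x : ℝ) (hx : 0 < x) (q : ℝ → ℝ) (hc : ContinuousOn q (Ioi 0)) (L : ℝ)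
    (h1 : ∀ u ∈ Ioi (0:ℝ), |q u - q x| ≤ L * |u - x|) :
    Bd (fun h => (Egamma x h (fun u => (u - x) ^ 3 * q u)) / h ^ 2) := by
  refine Bd.of_close (s := fun h => h ^ 2) (m := fun h => q x * (5 * x + 6 * h))
    (r := fun h => L * (3 * x ^ 2 + 26 * x * h + 24 * (h * h)))
    (fun h a => by positivity)
    (((Bd.const _).mul ((Bd.const _).add ((Bd.const _).mul Bd.self))))
    ((Bd.const _).mul (((Bd.const _).add ((Bd.const _).mul Bd.self)).add
      ((Bd.const _).mul (Bd.self.mul Bd.self)))) ?_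
  intro h a b
  have := E_close x h hx a 0 0 0 (q x) 0 0 L (fun u => (u - x) ^ 3 * q u)
    ((by fun_prop : ContinuousOn (fun u : ℝ => (u - x) ^ 3) (Ioi 0)).mul hc) (by
    intro u hu
    have : |(u - x) ^ 3| * |q u - q x| ≤ |(u - x) ^ 3| * (L * |u - x|) :=
      mul_le_mul_of_nonneg_left (h1 u hu) (abs_nonneg _)
    rw [← abs_mul] at this
    convert this using 1
    · congr 1; ring
    · have e4 : (u - x) ^ 4 = |u - x| ^ 4 := by rw [← abs_pow, abs_of_nonneg (by positivity)]
      rw [e4, abs_pow]; ring)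
  convert this using 1
  · congr 1; ring
  · ring

/-- For `x > 0`, `p, g` C⁴-bounded on `(0,∞)` with `p(x) > 0`, setting
`α_k(x,h) = E[(ξ−x)^k p(ξ)]` and `β_k(x,h) = E[(ξ−x)^k g(ξ) p(ξ)]`, for all sufficiently
small `h > 0` the denominator `α₀α₂ − α₁²` is nonzero and
`(α₂β₂ − α₁β₃)/(α₀α₂ − α₁²) = g(x)·x·h + O(h²)` as `h → 0⁺`. -/
theorem bias_ratio_expansion (x : ℝ) (hx : 0 < x) (p g : ℝ → ℝ)
    (hp : C4Bounded p) (hg : C4Bounded g) (hpx : 0 < p x) :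
    ∃ h₀ > 0, ∃ C > 0, ∀ h : ℝ, 0 < h → h < h₀ →
      (Egamma x h p * Egamma x h (fun u => (u - x) ^ 2 * p u) -
          (Egamma x h (fun u => (u - x) * p u)) ^ 2 ≠ 0) ∧
      |(Egamma x h (fun u => (u - x) ^ 2 * p u) *
            Egamma x h (fun u => (u - x) ^ 2 * (g u * p u)) -
          Egamma x h (fun u => (u - x) * p u) *
            Egamma x h (fun u => (u - x) ^ 3 * (g u * p u))) /
          (Egamma x h p * Egamma x h (fun u => (u - x) ^ 2 * p u) -
            (Egamma x h (fun u => (u - x) * p u)) ^ 2) -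
        g x * x * h| ≤ C * h ^ 2 := by
  obtain ⟨pc, p1, Bp, Lp, Mp, pB, pL, pM⟩ := taylor_data x hx p hp
  obtain ⟨gc, g1, Bg, Lg, Mg, gB, gL, gM⟩ := taylor_data x hx g hg
  have qc : ContinuousOn (fun u => g u * p u) (Ioi 0) := gc.mul pc
  have qL : ∀ u ∈ Ioi (0:ℝ), |g u * p u - g x * p x| ≤ (Bg * Lp + Lg * |p x|) * |u - x| := by
    intro u hu
    have e : g u * p u - g x * p x = g u * (p u - p x) + (g u - g x) * p x := by ring
    have t1 := mul_le_mul (gB u hu) (pL u hu) (abs_nonneg _) ((abs_nonneg _).trans (gB u hu))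
    have t2 := mul_le_mul_of_nonneg_right (gL u hu) (abs_nonneg (p x))
    rw [e]
    refine (abs_add_le _ _).trans ?_
    rw [abs_mul, abs_mul]
    linarith
  have qM : ∀ u ∈ Ioi (0:ℝ), |g u * p u - g x * p x - (g x * p1 + g1 * p x) * (u - x)| ≤
      (Bg * Mp + |p1| * Lg + Mg * |p x|) * (u - x) ^ 2 := by
    intro u hu
    have e : g u * p u - g x * p x - (g x * p1 + g1 * p x) * (u - x) =
      g u * (p u - p x - p1 * (u - x)) + (p1 * (u - x)) * (g u - g x)
        + (g u - g x - g1 * (u - x)) * p x := by ring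
    have t1 := mul_le_mul (gB u hu) (pM u hu) (abs_nonneg _) ((abs_nonneg _).trans (gB u hu))
    have t2 := mul_le_mul_of_nonneg_right (gM u hu) (abs_nonneg (p x))
    have t3 := mul_le_mul_of_nonneg_left (gL u hu) (abs_nonneg (p1 * (u - x)))
    have t4 : |p1 * (u - x)| * (Lg * |u - x|) = |p1| * Lg * (u - x) ^ 2 := by
      rw [abs_mul, ← sq_abs (u - x)]; ring
    rw [t4] at t3
    rw [e]
    refine (abs_add_three _ _ _).trans ?_
    rw [abs_mul, abs_mul (p1 * (u - x)), abs_mul (g u - g x - g1 * (u - x))]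
    linarith
  have bA0 := alpha0 x hx p pc p1 Mp pM
  have bA1 := alpha1 x hx p pc Lp pL
  have bA2 := alpha2 x hx p pc p1 Mp pM
  have bB2 := alpha2 x hx (fun u => g u * p u) qc _ _ qM
  have bB3 := alpha3 x hx (fun u => g u * p u) qc _ qL
  set a0 := fun h => Egamma x h p with ha0
  set a1 := fun h => Egamma x h (fun u => (u - x) * p u) with ha1
  set a2 := fun h => Egamma x h (fun u => (u - x) ^ 2 * p u) with ha2
  set b2 := fun h => Egamma x h (fun u => (u - x) ^ 2 * (g u * p u)) with hb2
  set b3 := fun h => Egamma x h (fun u => (u - x) ^ 3 * (g u * p u)) with hb3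
  change Bd (fun h => (a0 h - p x) / h) at bA0
  change Bd (fun h => a1 h / h) at bA1
  change Bd (fun h => (a2 h - p x * x * h) / h ^ 2) at bA2
  change Bd (fun h => (b2 h - g x * p x * x * h) / h ^ 2) at bB2
  change Bd (fun h => b3 h / h ^ 2) at bB3
  set A0 := fun h => (a0 h - p x) / h with hA0
  set A1 := fun h => a1 h / h with hA1
  set A2 := fun h => (a2 h - p x * x * h) / h ^ 2 with hA2
  set B2 := fun h => (b2 h - g x * p x * x * h) / h ^ 2 with hB2
  set B3 := fun h => b3 h / h ^ 2 with hB3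
  have bW : Bd (fun h => (p x * x) * A0 h + p x * A2 h + h * (A0 h * A2 h) - A1 h * A1 h) :=
    ((((Bd.const _).mul bA0).add ((Bd.const _).mul bA2)).add
      (Bd.self.mul (bA0.mul bA2))).sub (bA1.mul bA1)
  set W := fun h => (p x * x) * A0 h + p x * A2 h + h * (A0 h * A2 h) - A1 h * A1 h with hW
  have bZ : Bd (fun h => (p x * x) * B2 h + (g x * p x * x) * A2 h + h * (A2 h * B2 h)
      - A1 h * B3 h - (g x * x) * W h) :=
    (((((Bd.const _).mul bB2).add ((Bd.const _).mul bA2)).add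
      (Bd.self.mul (bA2.mul bB2))).sub (bA1.mul bB3)).sub ((Bd.const _).mul bW)
  obtain ⟨K, hK⟩ := bW
  obtain ⟨Q, hQ⟩ := bZ
  have c0 : 0 < p x ^ 2 * x := by positivity
  have K0 : 0 < |K| + 1 := by positivity
  refine ⟨min 1 (p x ^ 2 * x / (2 * (|K| + 1))), by positivity,
    2 * (|Q| + 1) / (p x ^ 2 * x), by positivity, ?_⟩
  intro h h0 hlt
  have hl1 : h < 1 := lt_of_lt_of_le hlt (min_le_left _ _)
  have hl2 : h < p x ^ 2 * x / (2 * (|K| + 1)) := lt_of_lt_of_le hlt (min_le_right _ _)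
  change a0 h * a2 h - a1 h ^ 2 ≠ 0 ∧
    |(a2 h * b2 h - a1 h * b3 h) / (a0 h * a2 h - a1 h ^ 2) - g x * x * h| ≤ _
  have eA0 : a0 h = p x + h * A0 h := by simp only [hA0]; field_simp; ring
  have eA1 : a1 h = h * A1 h := by simp only [hA1]; field_simp
  have eA2 : a2 h = p x * x * h + h ^ 2 * A2 h := by simp only [hA2]; field_simp; ring
  have eB2 : b2 h = g x * p x * x * h + h ^ 2 * B2 h := by simp only [hB2]; field_simp; ring
  have eB3 : b3 h = h ^ 2 * B3 h := by simp only [hB3]; field_simp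
  have eD : a0 h * a2 h - a1 h ^ 2 = h * (p x ^ 2 * x + h * W h) := by
    rw [eA0, eA1, eA2]; simp only [hW]; ring
  have wK : |W h| ≤ |K| + 1 := (hK h h0 hl1).trans (by linarith [le_abs_self K])
  have hD : p x ^ 2 * x / 2 ≤ p x ^ 2 * x + h * W h := by
    rw [lt_div_iff₀ (by positivity)] at hl2
    have := mul_le_mul_of_nonneg_left (neg_le_of_abs_le wK) h0.le
    nlinarith
  have hDp : 0 < p x ^ 2 * x + h * W h := by linarith
  have hDD : 0 < a0 h * a2 h - a1 h ^ 2 := by rw [eD]; positivity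
  refine ⟨hDD.ne', ?_⟩
  have hZ := hQ h h0 hl1
  have eN : (a2 h * b2 h - a1 h * b3 h) - g x * x * h * (a0 h * a2 h - a1 h ^ 2) =
      h ^ 3 * ((p x * x) * B2 h + (g x * p x * x) * A2 h + h * (A2 h * B2 h)
      - A1 h * B3 h - (g x * x) * W h) := by
    rw [eD, eA1, eA2, eB2, eB3]; ring
  rw [div_sub' hDD.ne', abs_div, abs_of_pos hDD, div_le_iff₀ hDD,
    show a2 h * b2 h - a1 h * b3 h - (a0 h * a2 h - a1 h ^ 2) * (g x * x * h) =
      (a2 h * b2 h - a1 h * b3 h) - g x * x * h * (a0 h * a2 h - a1 h ^ 2) by ring, eN,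
    abs_mul, abs_of_pos (pow_pos h0 3), eD]
  calc _ ≤ h ^ 3 * (|Q| + 1) :=
        mul_le_mul_of_nonneg_left (hZ.trans (by linarith [le_abs_self Q])) (by positivity)
    _ = 2 * (|Q| + 1) / (p x ^ 2 * x) * h ^ 2 * (h * (p x ^ 2 * x / 2)) := by field_simp
    _ ≤ _ := by gcongr
end
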